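/- arXiv:2603.22664 — 3 statements merged into one kernel-verified Lean document; each statement's English description precedes it below -/
import Mathlib

section
/- Let p be an even integer with 2 ≤ p < d. For each n ∈ ℕ, let f̃_{n,p,d} denote the orthogonal projection in L²(γ_p^n) of the function x ↦ ‖x‖_p^d = (Σ_{i=1}^n |x_i|^p)^{d/p} onto the finite-dimensional subspace of L²(γ_p^n) consisting of polynomial functions of total degree at most d. Then there exists a constant C_{p,d} > 0 such that for every n: coeff_d(f̃_{n,p,d})² ≤ C_{p,d} · n^{d/p}, where coeff_d(f̃_{n,p,d}) is the coefficient norm of the degree-d homogeneous part of the polynomial f̃_{n,p,d}. -/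
open MeasureTheory

noncomputable section

/-- Variance of a real function with respect to a measure. -/
def mVar {α : Type*} [MeasurableSpace α] (μ : Measure α) (f : α → ℝ) : ℝ :=
  (∫ x, f x ^ 2 ∂μ) - (∫ x, f x ∂μ) ^ 2

/-- The `p`-Gaussian probability measure on ℝ, with density `e^{-|x|^p} / ((2/p) Γ(1/p))`. -/
def gammaP (p : ℝ) : Measure ℝ :=
  volume.withDensity fun x =>
    ENNReal.ofReal (Real.exp (-|x| ^ p) / ((2 / p) * Real.Gamma (1 / p)))

/-- The `n`-fold product of the `p`-Gaussian measure, on ℝ^n. -/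
def gammaPn (p : ℝ) (n : ℕ) : Measure (Fin n → ℝ) :=
  Measure.pi fun _ => gammaP p

/-- `coeffNorm d f` is `coeff_d(f)`, the ℓ² norm of the coefficients of the degree-`d`
homogeneous part of `f`. -/
def coeffNorm {n : ℕ} (d : ℕ) (f : MvPolynomial (Fin n) ℝ) : ℝ :=
  Real.sqrt (∑ I ∈ f.support.filter (fun I => (I.sum fun _ e => e) = d),
    (MvPolynomial.coeff I f) ^ 2)

theorem integrable_rpow_abs_mul_exp_neg_rpow_abs {p s : ℝ} (hp : 0 < p) (hs : -1 < s) :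
    Integrable fun x : ℝ => |x| ^ s * Real.exp (-|x| ^ p) := by
  have h := integrableOn_rpow_mul_exp_neg_rpow hs hp
  have h1 : IntegrableOn (fun x : ℝ => |x| ^ s * Real.exp (-|x| ^ p)) (Set.Ioi 0) :=
    h.congr_fun (fun x hx => by simp only [abs_of_pos (Set.mem_Ioi.1 hx)]) measurableSet_Ioi
  rw [← integrableOn_univ, ← Set.Iic_union_Ioi (a := (0 : ℝ)), integrableOn_union]
  refine ⟨?_, h1⟩
  rw [integrableOn_Iic_iff_integrableOn_Iio]
  have := (Measure.measurePreserving_neg (volume : Measure ℝ)).integrableOn_comp_preimage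
    (Homeomorph.neg ℝ).measurableEmbedding
    (f := fun x : ℝ => |x| ^ s * Real.exp (-|x| ^ p)) (s := Set.Ioi 0)
  simpa [Function.comp_def] using this.2 h1

theorem isProbabilityMeasure_gammaP {p : ℝ} (hp : 0 < p) : IsProbabilityMeasure (gammaP p) := by
  have hG : 0 < 2 / p * Real.Gamma (1 / p) := by
    have := Real.Gamma_pos_of_pos (one_div_pos.2 hp); positivity
  have hi : Integrable fun x : ℝ => Real.exp (-|x| ^ p) / (2 / p * Real.Gamma (1 / p)) := by
    have := integrable_rpow_abs_mul_exp_neg_rpow_abs hp (s := 0) (by norm_num)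
    simp only [Real.rpow_zero, one_mul] at this
    exact this.div_const _
  constructor
  rw [gammaP, withDensity_apply _ .univ, Measure.restrict_univ,
    ← ofReal_integral_eq_lintegral_ofReal hi (.of_forall fun x => by positivity),
    integral_div, integral_comp_abs (f := fun x => Real.exp (-x ^ p)),
    integral_exp_neg_rpow hp, Real.Gamma_add_one (by positivity), ENNReal.ofReal_eq_one]
  have := (Real.Gamma_pos_of_pos (one_div_pos.2 hp)).ne'
  field_simp

instance nullSingletonClass_gammaP (p : ℝ) : NullSingletonClass (gammaP p) := by
  unfold gammaP; infer_instance

theorem integrable_pow_gammaP {p : ℝ} (hp : 0 < p) (j : ℕ) :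
    Integrable (fun x : ℝ => x ^ j) (gammaP p) := by
  have hG : 0 < 2 / p * Real.Gamma (1 / p) := by
    have := Real.Gamma_pos_of_pos (one_div_pos.2 hp); positivity
  rw [gammaP, integrable_withDensity_iff (by fun_prop) (by simp)]
  have := (integrable_rpow_abs_mul_exp_neg_rpow_abs hp (s := j)
    (by have : (0 : ℝ) ≤ j := j.cast_nonneg; linarith)).div_const (2 / p * Real.Gamma (1 / p))
  refine this.mono (by fun_prop) (.of_forall fun x => ?_)
  rw [ENNReal.toReal_ofReal (by positivity), Real.rpow_natCast]
  simp [mul_div_assoc]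

section MomentDuals

variable (μ : Measure ℝ)

theorem integrable_polynomial (hμ : ∀ j : ℕ, Integrable (fun x : ℝ => x ^ j) μ)
    (q : Polynomial ℝ) : Integrable (fun x => q.eval x) μ := by
  simp only [Polynomial.eval_eq_sum_range]
  exact integrable_finsetSum _ fun i _ => (hμ i).const_mul _

theorem eq_zero_of_integral_polynomial_mul_self [NullSingletonClass μ] [NeZero μ]
    (hμ : ∀ j : ℕ, Integrable (fun x : ℝ => x ^ j) μ)
    (q : Polynomial ℝ) (hq : ∫ x, q.eval x * q.eval x ∂μ = 0) : q = 0 := by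
  by_contra h0
  have hi : Integrable (fun x => q.eval x * q.eval x) μ := by
    simpa using integrable_polynomial μ hμ (q * q)
  rw [integral_eq_zero_iff_of_nonneg (fun x => mul_self_nonneg _) hi] at hq
  have h2 : ∀ᵐ x ∂μ, x ∉ (q.roots.toFinset : Set ℝ) :=
    measure_eq_zero_iff_ae_notMem.1 (Set.Finite.measure_zero (Finset.finite_toSet _) μ)
  have h3 : ∀ᵐ x ∂μ, False := by
    filter_upwards [hq, h2] with x hx hx2
    simp_all
  exact NeZero.ne μ (by simpa using h3)

/-- Up to normalisation, `q` is the `a`-th orthogonal polynomial of `μ`. -/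
theorem exists_polynomial_dual_pow [NullSingletonClass μ] [NeZero μ]
    (hμ : ∀ j : ℕ, Integrable (fun x : ℝ => x ^ j) μ) (a : ℕ) :
    ∃ q : Polynomial ℝ, q.natDegree ≤ a ∧ (∀ j < a, ∫ x, x ^ j * q.eval x ∂μ = 0) ∧
      ∫ x, x ^ a * q.eval x ∂μ = 1 := by
  have hi : ∀ (j : ℕ) (q : Polynomial ℝ), Integrable (fun x => x ^ j * q.eval x) μ := fun j q => by
    refine (integrable_polynomial μ hμ (Polynomial.X ^ j * q)).congr (.of_forall fun x => ?_)
    simp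
  have hdeg : ∀ q ∈ Polynomial.degreeLT ℝ (a + 1), q.natDegree < a + 1 := fun q hq => by
    rw [Polynomial.mem_degreeLT] at hq
    by_cases h0 : q = 0
    · simp [h0]
    · exact (Polynomial.natDegree_lt_iff_degree_lt h0).2 hq
  let T : Polynomial.degreeLT ℝ (a + 1) →ₗ[ℝ] (Fin (a + 1) → ℝ) :=
    { toFun := fun q j => ∫ x, x ^ (j : ℕ) * (q : Polynomial ℝ).eval x ∂μ
      map_add' := fun q r => by
        ext j
        simp only [Submodule.coe_add, Polynomial.eval_add, mul_add, Pi.add_apply]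
        exact integral_add (hi _ _) (hi _ _)
      map_smul' := fun c q => by
        ext j
        simp only [Submodule.coe_smul, Polynomial.eval_smul, smul_eq_mul, Pi.smul_apply,
          RingHom.id_apply, mul_left_comm _ c, integral_const_mul] }
  have hT : Function.Injective T := by
    rw [injective_iff_map_eq_zero]
    rintro ⟨q, hq⟩ h
    have hd := hdeg q hq
    have : q = 0 := by
      refine eq_zero_of_integral_polynomial_mul_self μ hμ q ?_
      have : ∀ x, q.eval x * q.eval x
          = ∑ i ∈ Finset.range (a + 1), q.coeff i * (x ^ i * q.eval x) := fun x => by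
        conv_lhs => rw [Polynomial.eval_eq_sum_range' hd, ← Polynomial.eval_eq_sum_range' hd,
          Polynomial.eval_eq_sum_range' hd, Finset.sum_mul]
        simp only [← Polynomial.eval_eq_sum_range' hd, mul_assoc]
      simp only [this]
      rw [integral_finsetSum _ fun i _ => (hi _ _).const_mul _]
      refine Finset.sum_eq_zero fun i hi => ?_
      rw [integral_const_mul]
      have := congrFun h ⟨i, Finset.mem_range.1 hi⟩
      simp only [T, LinearMap.coe_mk, AddHom.coe_mk, Pi.zero_apply] at this
      rw [this, mul_zero]
    simp [this]
  have hs : Function.Surjective T := by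
    have e := (Polynomial.degreeLTEquiv ℝ (a + 1))
    have : FiniteDimensional ℝ (Polynomial.degreeLT ℝ (a + 1)) := e.symm.finiteDimensional
    exact (LinearMap.injective_iff_surjective_of_finrank_eq_finrank e.finrank_eq).1 hT
  obtain ⟨⟨q, hq⟩, h⟩ := hs (Pi.single (Fin.last a) 1)
  refine ⟨q, Nat.lt_succ_iff.1 (hdeg q hq), fun j hj => ?_, ?_⟩
  · have := congrFun h ⟨j, by omega⟩
    rw [Pi.single_eq_of_ne (by simp [Fin.ext_iff]; omega)] at this
    exact this
  · have := congrFun h (Fin.last a)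
    rw [Pi.single_eq_same] at this
    exact this

end MomentDuals

/-- Bounded-order moments of a sum of functions of independent coordinates, against a product
weight: a Chernoff-type bound in terms of the one-dimensional truncated generating functions. -/
theorem abs_integral_sum_pow_mul_prod_le {ι : Type*} [Fintype ι] {α : Type*} [MeasurableSpace α]
    (μ : Measure α) [SigmaFinite μ] (y : α → ℝ) (k : ι → α → ℝ)
    (hint : ∀ i l, Integrable (fun x => y x ^ l * k i x) μ) {θ : ℝ} (hθ : 0 < θ) (j : ℕ) :
    Integrable (fun x : ι → α => (∑ i, y (x i)) ^ j * ∏ i, k i (x i)) (Measure.pi fun _ => μ) ∧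
    |∫ x, (∑ i, y (x i)) ^ j * ∏ i, k i (x i) ∂(Measure.pi fun _ : ι => μ)| ≤
      j.factorial * (θ ^ j)⁻¹ *
        ∏ i, ∑ l ∈ Finset.range (j + 1), |∫ x, y x ^ l * k i x ∂μ| * θ ^ l := by
  classical
  have hexp : ∀ x : ι → α, (∑ i, y (x i)) ^ j * ∏ i, k i (x i) =
      ∑ e ∈ Finset.univ.piAntidiag j, (Nat.multinomial Finset.univ e : ℝ) *
        ∏ i, (y (x i) ^ e i * k i (x i)) := fun x => by
    rw [Finset.sum_pow_eq_sum_piAntidiag, Finset.sum_mul]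
    simp only [Finset.prod_mul_distrib, mul_assoc]
  have hI : ∀ e : ι → ℕ, Integrable (fun x : ι → α => ∏ i, (y (x i) ^ e i * k i (x i)))
      (Measure.pi fun _ => μ) := fun e =>
    Integrable.fintype_prod (f := fun i x => y x ^ e i * k i x) fun i => hint i (e i)
  simp only [hexp]
  refine ⟨integrable_finsetSum _ fun e _ => (hI e).const_mul _, ?_⟩
  rw [integral_finsetSum _ fun e _ => (hI e).const_mul _]
  refine (Finset.abs_sum_le_sum_abs _ _).trans ?_
  have hsub : (Finset.univ.piAntidiag j : Finset (ι → ℕ)) ⊆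
      Fintype.piFinset fun _ => Finset.range (j + 1) := fun e he => by
    rw [Finset.mem_piAntidiag] at he
    rw [Fintype.mem_piFinset]
    intro i
    have := Finset.single_le_sum (f := e) (fun _ _ => Nat.zero_le _) (Finset.mem_univ i)
    rw [Finset.mem_range]; exact Nat.lt_succ_of_le (this.trans he.1.le)
  rw [Finset.prod_univ_sum, Finset.mul_sum]
  refine (Finset.sum_le_sum fun e he => ?_).trans
    (Finset.sum_le_sum_of_subset_of_nonneg hsub fun e _ _ => by positivity)
  rw [integral_const_mul, integral_fintype_prod_eq_prod (fun i x => y x ^ e i * k i x),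
    Finset.prod_mul_distrib, Finset.prod_pow_eq_pow_sum, (Finset.mem_piAntidiag.1 he).1, abs_mul,
    Finset.abs_prod, Nat.abs_cast]
  have hm : (Nat.multinomial Finset.univ e : ℝ) ≤ j.factorial := by
    have h := Nat.multinomial_spec Finset.univ e
    rw [(Finset.mem_piAntidiag.1 he).1] at h
    exact_mod_cast h ▸ Nat.le_mul_of_pos_left _ (Finset.prod_pos fun i _ => Nat.factorial_pos _)
  calc _ ≤ (j.factorial : ℝ) * ∏ i, |∫ x, y x ^ e i * k i x ∂μ| := by gcongr
    _ = _ := by field_simp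

/-- Taylor approximation of `z ↦ z ^ s` at `1`, with a remainder controlled on all of `[0, ∞)`. -/
theorem exists_rpow_sub_taylor_bound (s : ℝ) (hs : 0 ≤ s) (J : ℕ) (hJ : s ≤ J) :
    ∃ (c : ℕ → ℝ) (C : ℝ), 0 ≤ C ∧ ∀ z : ℝ, 0 ≤ z →
      |z ^ s - ∑ j ∈ Finset.range J, c j * (z - 1) ^ j| ≤ C * |z - 1| ^ J := by
  have han : AnalyticAt ℝ (fun z : ℝ => z ^ s) 1 :=
    (Real.contDiffAt_rpow_const_of_ne (n := ⊤) one_ne_zero).analyticAt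
  obtain ⟨P, hP⟩ := han
  have h := hP.isBigO_sub_partialSum_pow J
  obtain ⟨C₁, h⟩ := h.bound
  obtain ⟨δ, hδ, h⟩ := Metric.eventually_nhds_iff.1 h
  let c : ℕ → ℝ := fun j => P j fun _ => 1
  have hps : ∀ y : ℝ, P.partialSum J y = ∑ j ∈ Finset.range J, c j * y ^ j := fun y => by
    refine Finset.sum_congr rfl fun j _ => ?_
    simp [c, mul_comm]
  let D : ℝ := 1 + 1 / δ
  have hD : 1 ≤ D := le_add_of_nonneg_right (by positivity)
  refine ⟨c, |C₁| + (D ^ J + ∑ j ∈ Finset.range J, |c j| * (1 / δ) ^ (J - j)), by positivity,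
    fun z hz => ?_⟩
  rcases lt_or_ge |z - 1| δ with hlt | hge
  · have := @h (z - 1) (by simpa [Real.dist_eq] using hlt)
    rw [hps, norm_pow] at this
    simp only [add_sub_cancel, Real.norm_eq_abs, abs_abs] at this
    refine this.trans ?_
    gcongr
    have : 0 ≤ D ^ J + ∑ j ∈ Finset.range J, |c j| * (1 / δ) ^ (J - j) := by positivity
    linarith [le_abs_self C₁]
  · set u := |z - 1| with hu
    have hu1 : 1 ≤ 1 / δ * u := by rw [one_div_mul_eq_div, le_div_iff₀ hδ]; linarith
    have hz1 : z ^ s ≤ D ^ J * u ^ J := by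
      have h1 : z ≤ D * u := by
        have := le_abs_self (z - 1)
        simp only [D]; nlinarith
      have h2 : 1 ≤ D * u := by simp only [D]; nlinarith
      calc z ^ s ≤ (D * u) ^ s := by gcongr
        _ ≤ (D * u) ^ (J : ℝ) := Real.rpow_le_rpow_of_exponent_le h2 hJ
        _ = _ := by rw [Real.rpow_natCast, mul_pow]
    have hsum : |∑ j ∈ Finset.range J, c j * (z - 1) ^ j| ≤
        (∑ j ∈ Finset.range J, |c j| * (1 / δ) ^ (J - j)) * u ^ J := by
      rw [Finset.sum_mul]
      refine (Finset.abs_sum_le_sum_abs _ _).trans (Finset.sum_le_sum fun j hj => ?_)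
      have hj' := (Finset.mem_range.1 hj).le
      rw [abs_mul, abs_pow, ← hu, mul_assoc]
      gcongr
      rw [← Nat.sub_add_cancel hj', pow_add u, ← mul_assoc, Nat.sub_add_cancel hj', ← mul_pow]
      exact le_mul_of_one_le_left (by positivity) (one_le_pow₀ hu1)
    calc _ ≤ |z ^ s| + _ := abs_sub _ _
      _ ≤ D ^ J * u ^ J + (∑ j ∈ Finset.range J, |c j| * (1 / δ) ^ (J - j)) * u ^ J := by
        rw [abs_of_nonneg (Real.rpow_nonneg hz s)]; gcongr
      _ ≤ _ := by
        rw [← add_mul]; exact mul_le_mul_of_nonneg_right (by linarith [abs_nonneg C₁]) (by positivity)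

theorem sum_range_mul_pow_le {b : ℕ → ℝ} (hb : ∀ l, 0 ≤ b l) {J j a m : ℕ} (hj : j ≤ J) {K θ : ℝ}
    (hK : 1 ≤ K) (hsum : ∑ l ∈ Finset.range (J + 1), b l ≤ K) (hθ : 0 ≤ θ) (hθ1 : θ ≤ 1)
    (h0 : a = 0 → b 0 ≤ 1 ∧ b 1 = 0 ∧ m = 0) (hm : ∀ l < m, b l = 0) :
    ∑ l ∈ Finset.range (j + 1), b l * θ ^ l ≤ (1 + K * θ ^ 2) * K ^ a * θ ^ m := by
  have hsum' : ∑ l ∈ Finset.range (j + 1), b l ≤ K :=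
    (Finset.sum_le_sum_of_subset_of_nonneg (Finset.range_mono (by omega))
      fun l _ _ => hb l).trans hsum
  rcases Nat.eq_zero_or_pos a with rfl | ha
  · obtain ⟨hb0, hb1, rfl⟩ := h0 rfl
    calc _ ≤ ∑ l ∈ Finset.range (j + 1), ((if l = 0 then 1 else 0) + b l * θ ^ 2) := by
          refine Finset.sum_le_sum fun l _ => ?_
          rcases l with _ | _ | l
          · have := mul_nonneg (hb 0) (sq_nonneg θ)
            simp only [pow_zero, mul_one, if_true]; linarith
          · simp [hb1]
          · simp only [Nat.add_eq_zero_iff, one_ne_zero, and_false, if_false, zero_add]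
            exact mul_le_mul_of_nonneg_left (pow_le_pow_of_le_one hθ hθ1 (by omega)) (hb _)
      _ = 1 + (∑ l ∈ Finset.range (j + 1), b l) * θ ^ 2 := by
          rw [Finset.sum_add_distrib, Finset.sum_mul]; simp
      _ ≤ _ := by rw [pow_zero, pow_zero, mul_one, mul_one]; gcongr
  · calc _ ≤ ∑ l ∈ Finset.range (j + 1), b l * θ ^ m := by
          refine Finset.sum_le_sum fun l _ => ?_
          rcases lt_or_ge l m with h | h
          · simp [hm l h]
          · exact mul_le_mul_of_nonneg_left (pow_le_pow_of_le_one hθ hθ1 h) (hb _)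
      _ ≤ K * θ ^ m := by rw [← Finset.sum_mul]; gcongr
      _ ≤ (1 + K * θ ^ 2) * K ^ a * θ ^ m := by
          gcongr
          have h1 : K ≤ K ^ a := le_self_pow₀ hK ha.ne'
          exact h1.trans (le_mul_of_one_le_left (by positivity)
            (le_add_of_nonneg_right (by positivity)))

theorem prod_le_exp_mul {n : ℕ} {B : Fin n → ℝ} (hB0 : ∀ i, 0 ≤ B i) {α m : Fin n → ℕ} {K θ : ℝ}
    (hK : 0 ≤ K) (hθ : 0 ≤ θ) (hθn : θ ^ 2 * n ≤ 1)
    (hB : ∀ i, B i ≤ (1 + K * θ ^ 2) * K ^ α i * θ ^ m i) :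
    ∏ i, B i ≤ Real.exp K * K ^ (∑ i, α i) * θ ^ (∑ i, m i) := by
  refine (Finset.prod_le_prod (fun i _ => hB0 i) fun i _ => hB i).trans ?_
  rw [Finset.prod_mul_distrib, Finset.prod_mul_distrib, Finset.prod_pow_eq_pow_sum,
    Finset.prod_pow_eq_pow_sum, Finset.prod_const, Finset.card_univ, Fintype.card_fin]
  gcongr
  calc (1 + K * θ ^ 2) ^ n ≤ Real.exp (K * θ ^ 2) ^ n := by
        gcongr; rw [add_comm]; exact Real.add_one_le_exp _
    _ = Real.exp (K * (θ ^ 2 * n)) := by rw [← Real.exp_nat_mul]; ring_nf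
    _ ≤ _ := Real.exp_le_exp.2 (mul_le_of_le_one_right hK hθn)

/-- A family of polynomials orthogonal to all lower powers gains a factor `n⁻¹` for each power of
`∑ xᵢ ^ p` needed to see it. -/
theorem exists_abs_integral_rpow_mul_prod_le (μ : Measure ℝ) [IsProbabilityMeasure μ]
    (hμ : ∀ j : ℕ, Integrable (fun x : ℝ => x ^ j) μ) {p d : ℕ} (hp : 0 < p) (hpe : Even p)
    (hc : 0 < ∫ x, x ^ p ∂μ) (q : ℕ → Polynomial ℝ) (hq0 : q 0 = 1)
    (hq : ∀ a, ∀ j < a, ∫ x, x ^ j * (q a).eval x ∂μ = 0) {s : ℝ} (hs : 0 ≤ s) (hsd : s ≤ 2 * d) :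
    ∃ K : ℝ, 0 ≤ K ∧ ∀ n : ℕ, 1 ≤ n → ∀ α : Fin n → ℕ, ∑ i, α i = d →
      Integrable (fun x : Fin n → ℝ => (∑ i, x i ^ p) ^ s * ∏ i, (q (α i)).eval (x i))
        (Measure.pi fun _ => μ) ∧
      |∫ x, (∑ i, x i ^ p) ^ s * ∏ i, (q (α i)).eval (x i) ∂(Measure.pi fun _ : Fin n => μ)| ≤
        K * (n : ℝ) ^ s * ((n : ℝ)⁻¹) ^ (∑ i, α i ⌈/⌉ p) := by
  set c := ∫ x, x ^ p ∂μ with hcdef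
  let y : ℝ → ℝ := fun x => x ^ p - c
  have hyc : Continuous y := by fun_prop
  have hyq : ∀ a l, Integrable (fun x => y x ^ l * (q a).eval x) μ := fun a l => by
    refine (integrable_polynomial μ hμ
      ((Polynomial.X ^ p - Polynomial.C c) ^ l * q a)).congr (.of_forall fun x => ?_)
    simp [y]
  have hyq' : ∀ a l, Integrable (fun x => y x ^ l * |(q a).eval x|) μ := fun a l => by
    refine (hyq a l).mono (by fun_prop) (.of_forall fun x => ?_)
    simp
  have hvan : ∀ a l, p * l < a → ∫ x, y x ^ l * (q a).eval x ∂μ = 0 := fun a l hl => by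
    let r : Polynomial ℝ := (Polynomial.X ^ p - Polynomial.C c) ^ l
    have hr : r.natDegree < a := by
      refine lt_of_le_of_lt ?_ hl
      refine Polynomial.natDegree_pow_le.trans ?_
      rw [mul_comm, Polynomial.natDegree_X_pow_sub_C]
    have : ∀ x, y x ^ l * (q a).eval x =
        ∑ i ∈ Finset.range a, r.coeff i * (x ^ i * (q a).eval x) := fun x => by
      have h : y x ^ l = r.eval x := by simp [r, y]
      rw [h, Polynomial.eval_eq_sum_range' hr, Finset.sum_mul]
      simp only [mul_assoc]
    simp only [this]
    rw [integral_finsetSum]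
    · refine Finset.sum_eq_zero fun i hi => ?_
      rw [integral_const_mul, hq a i (Finset.mem_range.1 hi), mul_zero]
    · intro i _
      refine Integrable.const_mul ?_ _
      refine (integrable_polynomial μ hμ (Polynomial.X ^ i * q a)).congr (.of_forall fun x => ?_)
      simp
  have hy1 : ∫ x, y x ∂μ = 0 := by
    simp only [y]
    rw [integral_sub (hμ p) (integrable_const c)]
    simp [hcdef]
  let b : ℕ → ℕ → ℝ := fun a l => |∫ x, y x ^ l * (q a).eval x ∂μ|
  let b' : ℕ → ℕ → ℝ := fun a l => |∫ x, y x ^ l * |(q a).eval x| ∂μ|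
  let K : ℝ := 1 + ∑ a ∈ Finset.range (d + 1), ∑ l ∈ Finset.range (2 * d + 1), (b a l + b' a l)
  have hK1 : 1 ≤ K := le_add_of_nonneg_right (by positivity)
  have hbK : ∀ a ≤ d, ∑ l ∈ Finset.range (2 * d + 1), (b a l + b' a l) ≤ K := fun a ha => by
    have := Finset.single_le_sum
      (f := fun a => ∑ l ∈ Finset.range (2 * d + 1), (b a l + b' a l))
      (fun _ _ => by positivity) (Finset.mem_range.2 (Nat.lt_succ_of_le ha))
    exact this.trans (le_add_of_nonneg_left zero_le_one)
  obtain ⟨t, C, hC, ht⟩ := exists_rpow_sub_taylor_bound s hs (2 * d) (by exact_mod_cast hsd)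
  let E : ℝ := Real.exp K * K ^ d
  have hE : 0 ≤ E := by positivity
  refine ⟨c ^ s * (C * ((2 * d).factorial * (c ^ (2 * d))⁻¹ * E) +
    ∑ j ∈ Finset.range (2 * d), |t j| * (j.factorial * (c ^ j)⁻¹ * E)), by positivity,
    fun n hn α hα => ?_⟩
  have hn0 : (0 : ℝ) < n := by exact_mod_cast hn
  have hn1 : (1 : ℝ) ≤ n := by exact_mod_cast hn
  have hαd : ∀ i, α i ≤ d := fun i =>
    hα ▸ Finset.single_le_sum (f := α) (fun _ _ => Nat.zero_le _) (Finset.mem_univ i)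
  set M := ∑ i, α i ⌈/⌉ p with hM
  have hMd : M ≤ d := by
    rw [hM, ← hα]
    exact Finset.sum_le_sum fun i _ => (ceilDiv_le_iff_le_mul hp).2 (Nat.le_mul_of_pos_left _ hp)
  set A : ℝ := n * c with hA
  have hA0 : 0 < A := by positivity
  let Y : (Fin n → ℝ) → ℝ := fun x => ∑ i, y (x i)
  let H : (Fin n → ℝ) → ℝ := fun x => ∏ i, (q (α i)).eval (x i)
  let ν : Measure (Fin n → ℝ) := Measure.pi fun _ => μ
  have hN : ∀ x : Fin n → ℝ, ∑ i, x i ^ p = A * (1 + Y x / A) := fun x => by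
    simp only [Y, y, Finset.sum_sub_distrib, Finset.sum_const, Finset.card_univ, Fintype.card_fin,
      nsmul_eq_mul]
    field_simp; ring
  have hNnn : ∀ x : Fin n → ℝ, 0 ≤ ∑ i, x i ^ p := fun x =>
    Finset.sum_nonneg fun i _ => hpe.pow_nonneg _
  have hT : ∀ j, Integrable (fun x => Y x ^ j * H x) ν ∧ (j ≤ 2 * d →
      |∫ x, Y x ^ j * H x ∂ν| ≤ j.factorial * (((n : ℝ)⁻¹) ^ j)⁻¹ * (E * (n : ℝ)⁻¹ ^ M)) := by
    intro j
    have h := abs_integral_sum_pow_mul_prod_le μ y (fun i x => (q (α i)).eval x)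
      (fun i l => hyq (α i) l) (inv_pos.2 hn0) j
    refine ⟨h.1, fun hj => h.2.trans ?_⟩
    gcongr
    simp only [E, ← hα]
    refine prod_le_exp_mul (fun i => by positivity) (by positivity) (by positivity) ?_ fun i => ?_
    · rw [sq, mul_assoc, inv_mul_cancel₀ hn0.ne', mul_one]; exact inv_le_one_of_one_le₀ hn1
    · refine sum_range_mul_pow_le (b := b (α i)) (fun l => abs_nonneg _) hj hK1 ?_ (by positivity)
        (inv_le_one_of_one_le₀ hn1) (fun h0 => ?_) fun l hl => ?_
      · exact (Finset.sum_le_sum fun l _ => le_add_of_nonneg_right (abs_nonneg _)).trans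
          (hbK _ (hαd i))
      · simp [b, h0, hq0, hy1]
      · simp only [b]
        rw [hvan _ _ (not_le.1 fun h => hl.not_ge ((ceilDiv_le_iff_le_mul hp).2 h)), abs_zero]
  have hR : Integrable (fun x => Y x ^ (2 * d) * |H x|) ν ∧
      ∫ x, Y x ^ (2 * d) * |H x| ∂ν ≤ (2 * d).factorial * (n : ℝ) ^ d * E := by
    have hsq : 0 < √(n : ℝ) := Real.sqrt_pos.2 hn0
    have h := abs_integral_sum_pow_mul_prod_le μ y (fun i x => |(q (α i)).eval x|)
      (fun i l => hyq' (α i) l) (inv_pos.2 hsq) (2 * d)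
    simp only [H, Finset.abs_prod]
    refine ⟨h.1, (le_abs_self _).trans (h.2.trans ?_)⟩
    rw [← inv_pow, inv_inv, pow_mul, Real.sq_sqrt hn0.le]
    gcongr
    rw [← mul_one E, ← pow_zero (√(n : ℝ))⁻¹]
    have h0 : ∑ _i : Fin n, 0 = 0 := Finset.sum_const_zero
    rw [← h0]
    simp only [E, ← hα]
    refine prod_le_exp_mul (fun i => by positivity) (by positivity) (by positivity) ?_ fun i => ?_
    · rw [inv_pow, Real.sq_sqrt hn0.le, inv_mul_cancel₀ hn0.ne']
    · refine sum_range_mul_pow_le (b := b' (α i)) (fun l => abs_nonneg _) le_rfl hK1 ?_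
        (by positivity) (inv_le_one_of_one_le₀ (Real.one_le_sqrt.2 hn1)) (fun h0 => ?_)
        fun l hl => absurd hl (Nat.not_lt_zero l)
      · rw [hα]
        exact (Finset.sum_le_sum fun l _ => le_add_of_nonneg_left (abs_nonneg _)).trans
          (hbK _ (hαd i))
      · simp [b', h0, hq0, hy1]
  let P : (Fin n → ℝ) → ℝ := fun x => ∑ j ∈ Finset.range (2 * d), t j * (Y x / A) ^ j
  let R : (Fin n → ℝ) → ℝ := fun x => (1 + Y x / A) ^ s - P x
  have hRb : ∀ x, |R x * H x| ≤ C * (A ^ (2 * d))⁻¹ * (Y x ^ (2 * d) * |H x|) := fun x => by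
    have h := ht (1 + Y x / A) (by
      have := hNnn x; rw [hN] at this; exact nonneg_of_mul_nonneg_right this hA0)
    rw [add_sub_cancel_left, pow_mul, sq_abs, ← pow_mul, div_pow] at h
    rw [abs_mul]
    calc _ ≤ C * (Y x ^ (2 * d) / A ^ (2 * d)) * |H x| := by gcongr
      _ = _ := by ring
  have hYc : Continuous Y := by fun_prop
  have hHc : Continuous H := by fun_prop
  have hPc : Continuous P := by fun_prop
  have hRc : Continuous R :=
    ((continuous_const.add (hYc.div_const A)).rpow_const fun _ => Or.inr hs).sub hPc
  have hRi : Integrable (fun x => R x * H x) ν :=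
    (hR.1.const_mul (C * (A ^ (2 * d))⁻¹)).mono' (hRc.mul hHc).aestronglyMeasurable
      (.of_forall hRb)
  have hdecomp : ∀ x : Fin n → ℝ, (∑ i, x i ^ p) ^ s * ∏ i, (q (α i)).eval (x i) =
      A ^ s * (R x * H x + ∑ j ∈ Finset.range (2 * d), t j * (A ^ j)⁻¹ * (Y x ^ j * H x)) := by
    intro x
    have h := hNnn x
    rw [hN] at h ⊢
    rw [Real.mul_rpow hA0.le (nonneg_of_mul_nonneg_right h hA0), mul_assoc]
    congr 1
    have : ∑ j ∈ Finset.range (2 * d), t j * (A ^ j)⁻¹ * (Y x ^ j * H x) = P x * H x := by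
      simp only [P]
      rw [Finset.sum_mul]
      refine Finset.sum_congr rfl fun j _ => ?_
      rw [div_pow]; ring
    rw [this]
    simp only [R, H]; ring
  have hSi : ∀ j ∈ Finset.range (2 * d),
      Integrable (fun x => t j * (A ^ j)⁻¹ * (Y x ^ j * H x)) ν := fun j _ => (hT j).1.const_mul _
  have hSi' := integrable_finsetSum _ hSi
  simp only [hdecomp]
  refine ⟨(hRi.add hSi').const_mul _, ?_⟩
  rw [integral_const_mul, integral_add hRi hSi', integral_finsetSum _ hSi, abs_mul,
    abs_of_nonneg (by positivity : 0 ≤ A ^ s)]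
  have hrem : |∫ x, R x * H x ∂ν| ≤
      C * ((2 * d).factorial * (c ^ (2 * d))⁻¹ * E) * (n : ℝ)⁻¹ ^ M := by
    calc |∫ x, R x * H x ∂ν| ≤ ∫ x, |R x * H x| ∂ν := abs_integral_le_integral_abs
      _ ≤ ∫ x, C * (A ^ (2 * d))⁻¹ * (Y x ^ (2 * d) * |H x|) ∂ν :=
        integral_mono hRi.abs (hR.1.const_mul _) hRb
      _ ≤ C * (A ^ (2 * d))⁻¹ * ((2 * d).factorial * (n : ℝ) ^ d * E) := by
        rw [integral_const_mul]; gcongr; exact hR.2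
      _ = C * ((2 * d).factorial * (c ^ (2 * d))⁻¹ * E) * (n : ℝ)⁻¹ ^ d := by
        rw [hA, mul_pow, two_mul, pow_add (n : ℝ), inv_pow]; field_simp
      _ ≤ _ := by
        refine mul_le_mul_of_nonneg_left ?_ (by positivity)
        exact pow_le_pow_of_le_one (by positivity) (inv_le_one_of_one_le₀ hn1) hMd
  have hpoly : |∑ j ∈ Finset.range (2 * d), ∫ x, t j * (A ^ j)⁻¹ * (Y x ^ j * H x) ∂ν| ≤
      (∑ j ∈ Finset.range (2 * d), |t j| * (j.factorial * (c ^ j)⁻¹ * E)) * (n : ℝ)⁻¹ ^ M := by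
    rw [Finset.sum_mul]
    refine (Finset.abs_sum_le_sum_abs _ _).trans (Finset.sum_le_sum fun j hj => ?_)
    rw [integral_const_mul, abs_mul, abs_mul, abs_of_nonneg (by positivity : 0 ≤ (A ^ j)⁻¹)]
    calc _ ≤ |t j| * (A ^ j)⁻¹ *
          (j.factorial * (((n : ℝ)⁻¹) ^ j)⁻¹ * (E * (n : ℝ)⁻¹ ^ M)) := by
          gcongr; exact (hT j).2 (Finset.mem_range.1 hj).le
      _ = _ := by rw [hA, mul_pow, inv_pow, inv_inv]; field_simp
  calc _ ≤ A ^ s * (C * ((2 * d).factorial * (c ^ (2 * d))⁻¹ * E) * (n : ℝ)⁻¹ ^ M +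
        (∑ j ∈ Finset.range (2 * d), |t j| * (j.factorial * (c ^ j)⁻¹ * E)) * (n : ℝ)⁻¹ ^ M) := by
        gcongr; exact (abs_add_le _ _).trans (add_le_add hrem hpoly)
    _ = _ := by rw [hA, Real.mul_rpow hn0.le hc.le]; ring

theorem eval_prod_aeval_X {n : ℕ} (q : Fin n → Polynomial ℝ) (x : Fin n → ℝ) :
    MvPolynomial.eval x (∏ i, Polynomial.aeval (MvPolynomial.X i) (q i)) =
      ∏ i, (q i).eval (x i) := by
  rw [map_prod]
  refine Finset.prod_congr rfl fun i _ => ?_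
  rw [Polynomial.aeval_def, Polynomial.hom_eval₂, MvPolynomial.eval_X, Polynomial.eval]
  congr 1
  ext; simp

theorem totalDegree_prod_aeval_X_le {n : ℕ} (q : Fin n → Polynomial ℝ) :
    (∏ i, Polynomial.aeval (MvPolynomial.X i : MvPolynomial (Fin n) ℝ) (q i)).totalDegree ≤
      ∑ i, (q i).natDegree := by
  refine (MvPolynomial.totalDegree_finsetProd _ _).trans (Finset.sum_le_sum fun i _ => ?_)
  rw [Polynomial.aeval_eq_sum_range]
  refine MvPolynomial.totalDegree_finsetSum_le fun j hj => ?_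
  refine (MvPolynomial.totalDegree_smul_le _ _).trans ?_
  rw [MvPolynomial.totalDegree_X_pow]
  exact Nat.lt_succ_iff.1 (Finset.mem_range.1 hj)

/-- Products of the dual polynomials read off the top-degree coefficients. -/
theorem integral_eval_mul_prod_eq_coeff (μ : Measure ℝ) [SigmaFinite μ]
    (hμ : ∀ j : ℕ, Integrable (fun x : ℝ => x ^ j) μ) (q : ℕ → Polynomial ℝ)
    (hq : ∀ a, ∀ j < a, ∫ x, x ^ j * (q a).eval x ∂μ = 0)
    (hq1 : ∀ a, ∫ x, x ^ a * (q a).eval x ∂μ = 1) {n : ℕ} (g : MvPolynomial (Fin n) ℝ)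
    (I : Fin n →₀ ℕ) (hg : g.totalDegree ≤ ∑ i, I i) :
    Integrable (fun x : Fin n → ℝ => MvPolynomial.eval x g * ∏ i, (q (I i)).eval (x i))
      (Measure.pi fun _ => μ) ∧
    ∫ x, MvPolynomial.eval x g * ∏ i, (q (I i)).eval (x i) ∂(Measure.pi fun _ : Fin n => μ) =
      MvPolynomial.coeff I g := by
  have hexp : ∀ x : Fin n → ℝ, MvPolynomial.eval x g * ∏ i, (q (I i)).eval (x i) =
      ∑ e ∈ g.support, g.coeff e * ∏ i, (x i ^ e i * (q (I i)).eval (x i)) := fun x => by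
    rw [MvPolynomial.eval_eq', Finset.sum_mul]
    simp only [Finset.prod_mul_distrib, mul_assoc]
  have hi : ∀ e : Fin n →₀ ℕ, Integrable
      (fun x : Fin n → ℝ => ∏ i, (x i ^ e i * (q (I i)).eval (x i))) (Measure.pi fun _ => μ) :=
    fun e => Integrable.fintype_prod (f := fun i x => x ^ e i * (q (I i)).eval x) fun i => by
      refine (integrable_polynomial μ hμ (Polynomial.X ^ e i * q (I i))).congr
        (.of_forall fun x => ?_)
      simp
  simp only [hexp]
  refine ⟨integrable_finsetSum _ fun e _ => (hi e).const_mul _, ?_⟩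
  rw [integral_finsetSum _ fun e _ => (hi e).const_mul _]
  simp only [integral_const_mul]
  rw [Finset.sum_eq_single I]
  · rw [integral_fintype_prod_eq_prod (fun i x => x ^ I i * (q (I i)).eval x)]
    simp [hq1]
  · intro e he hne
    rw [integral_fintype_prod_eq_prod (fun i x => x ^ e i * (q (I i)).eval x)]
    have : ∃ i, e i < I i := by
      by_contra! h
      refine hne (Finsupp.ext fun i => ?_)
      have hd : ∑ i, e i ≤ ∑ i, I i := by
        have := MvPolynomial.le_totalDegree he
        rw [Finsupp.sum_fintype _ _ fun _ => rfl] at this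
        exact this.trans hg
      exact ((Finset.sum_eq_sum_iff_of_le fun i _ => h i).1
        (le_antisymm (Finset.sum_le_sum fun i _ => h i) hd) i (Finset.mem_univ i)).symm
    obtain ⟨i, hlt⟩ := this
    rw [Finset.prod_eq_zero (Finset.mem_univ i) (hq _ _ hlt), mul_zero]
  · intro h
    rw [MvPolynomial.notMem_support_iff.1 h, zero_mul]

/-- Multi-indices of degree `d`, weighted by `n⁻¹` for each variable used, have bounded mass. -/
theorem sum_prod_ite_inv_le {n : ℕ} (hn : 1 ≤ n) (d : ℕ) (S : Finset (Fin n →₀ ℕ))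
    (hS : ∀ I ∈ S, ∑ i, I i = d) :
    ∑ I ∈ S, ∏ i, (if I i = 0 then 1 else (n : ℝ)⁻¹) ≤ Real.exp d := by
  classical
  have hn0 : (0 : ℝ) < n := by exact_mod_cast hn
  calc ∑ I ∈ S, ∏ i, (if I i = 0 then 1 else (n : ℝ)⁻¹)
      = ∑ f ∈ S.image (fun I : Fin n →₀ ℕ => (I : Fin n → ℕ)), ∏ i, (if f i = 0 then 1 else (n : ℝ)⁻¹) := by
        rw [Finset.sum_image fun _ _ _ _ h => DFunLike.coe_injective h]
    _ ≤ ∑ f ∈ Fintype.piFinset fun _ : Fin n => Finset.range (d + 1),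
          ∏ i, (if f i = 0 then 1 else (n : ℝ)⁻¹) := by
        refine Finset.sum_le_sum_of_subset_of_nonneg (fun f hf => ?_)
          fun f _ _ => Finset.prod_nonneg fun i _ => by positivity
        obtain ⟨I, hI, rfl⟩ := Finset.mem_image.1 hf
        refine Fintype.mem_piFinset.2 fun i => Finset.mem_range.2 (Nat.lt_succ_of_le ?_)
        rw [← hS I hI]
        exact Finset.single_le_sum (f := I) (fun _ _ => Nat.zero_le _) (Finset.mem_univ i)
    _ = (1 + d * (n : ℝ)⁻¹) ^ n := by
        rw [← Finset.prod_univ_sum (fun _ => Finset.range (d + 1))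
          (fun _ a => if a = 0 then (1 : ℝ) else (n : ℝ)⁻¹), Finset.prod_const, Finset.card_univ,
          Fintype.card_fin, Finset.sum_range_succ']
        simp [add_comm]
    _ ≤ Real.exp (d * (n : ℝ)⁻¹) ^ n := by
        gcongr; rw [add_comm]; exact Real.add_one_le_exp _
    _ = Real.exp d := by
        rw [← Real.exp_nat_mul]; congr 1; field_simp

/-- Lemma 2.12: let `p` be an even integer with `2 ≤ p < d`.  If `g` is the orthogonal
projection in `L²(γ_p^n)` of `x ↦ ‖x‖_p^d = (Σ |x_i|^p)^{d/p}` onto the subspace of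
polynomials of total degree at most `d` (characterized by the orthogonality relations below),
then `coeff_d(g)² ≤ C_{p,d} · n^{d/p}`. -/
theorem coeff_norm_of_projection_bound (p d : ℕ) (hpe : Even p) (hp2 : 2 ≤ p) (hpd : p < d) :
    ∃ C : ℝ, 0 < C ∧
      ∀ (n : ℕ), 1 ≤ n → ∀ g : MvPolynomial (Fin n) ℝ,
        g.totalDegree ≤ d →
        (∀ h : MvPolynomial (Fin n) ℝ, h.totalDegree ≤ d →
          ∫ x, ((∑ i, |x i| ^ (p : ℝ)) ^ ((d : ℝ) / p) - MvPolynomial.eval x g) *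
              MvPolynomial.eval x h ∂(gammaPn (p : ℝ) n) = 0) →
        coeffNorm d g ^ 2 ≤ C * (n : ℝ) ^ ((d : ℝ) / p) := by
  have hp0 : 0 < p := by omega
  have hpR : (0 : ℝ) < p := by exact_mod_cast hp0
  set μ := gammaP (p : ℝ) with hμdef
  have hprob : IsProbabilityMeasure μ := isProbabilityMeasure_gammaP hpR
  have hμ : ∀ j : ℕ, Integrable (fun x : ℝ => x ^ j) μ := integrable_pow_gammaP hpR
  have hc : 0 < ∫ x, x ^ p ∂μ := by
    have hnn : 0 ≤ ∫ x, x ^ p ∂μ := integral_nonneg fun x => hpe.pow_nonneg x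
    obtain ⟨r, hr⟩ := hpe
    refine hnn.lt_of_ne fun h => Polynomial.X_ne_zero (R := ℝ) ?_
    refine eq_zero_of_pow_eq_zero (n := r)
      (eq_zero_of_integral_polynomial_mul_self μ hμ _ ?_)
    simpa [← pow_add, ← hr] using h.symm
  have hex : ∀ a, ∃ q : Polynomial ℝ, (a = 0 → q = 1) ∧ q.natDegree ≤ a ∧
      (∀ j < a, ∫ x, x ^ j * q.eval x ∂μ = 0) ∧ ∫ x, x ^ a * q.eval x ∂μ = 1 := fun a => by
    rcases Nat.eq_zero_or_pos a with rfl | ha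
    · exact ⟨1, by simp⟩
    · obtain ⟨q, hq⟩ := exists_polynomial_dual_pow μ hμ a
      exact ⟨q, fun h => absurd h ha.ne', hq⟩
  choose q hq0 hqd hq hq1 using hex
  set s : ℝ := (d : ℝ) / p with hs
  have hsd : s ≤ 2 * d := by
    have : (1 : ℝ) ≤ p := by exact_mod_cast hp0
    have hd : (0 : ℝ) ≤ d := d.cast_nonneg
    exact (div_le_self hd this).trans (by linarith)
  obtain ⟨K, hK0, hK⟩ := exists_abs_integral_rpow_mul_prod_le μ hμ (d := d) hp0 hpe hc q
    (hq0 0 rfl) hq (by positivity : 0 ≤ s) hsd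
  refine ⟨K ^ 2 * Real.exp d + 1, by positivity, fun n hn g hg horth => ?_⟩
  have hn0 : (0 : ℝ) < n := by exact_mod_cast hn
  have hn1 : (1 : ℝ) ≤ n := by exact_mod_cast hn
  have hcoeff : ∀ I : Fin n →₀ ℕ, ∑ i, I i = d →
      MvPolynomial.coeff I g ^ 2 ≤
        K ^ 2 * (n : ℝ) ^ s * ∏ i, (if I i = 0 then 1 else (n : ℝ)⁻¹) := by
    intro I hI
    obtain ⟨hFi, hFb⟩ := hK n hn I hI
    obtain ⟨hgi, hgc⟩ := integral_eval_mul_prod_eq_coeff μ hμ q hq hq1 g I (hI ▸ hg)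
    have h := horth (∏ i, Polynomial.aeval (MvPolynomial.X i) (q (I i)))
      ((totalDegree_prod_aeval_X_le _).trans (hI ▸ Finset.sum_le_sum fun i _ => hqd _))
    simp only [eval_prod_aeval_X, Real.rpow_natCast, hpe.pow_abs, sub_mul] at h
    rw [gammaPn, integral_sub hFi hgi, hgc, sub_eq_zero] at h
    rw [h] at hFb
    set M := ∑ i, I i ⌈/⌉ p with hM
    have hMs : ((n : ℝ)⁻¹) ^ M ≤ (n : ℝ) ^ (-s) := by
      have : s ≤ M := by
        rw [hs, div_le_iff₀' hpR]
        have : d ≤ p * M := by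
          rw [hM, Finset.mul_sum, ← hI]
          exact Finset.sum_le_sum fun i _ => (ceilDiv_le_iff_le_mul hp0).1 le_rfl
        exact_mod_cast this
      rw [inv_pow, ← Real.rpow_natCast, ← Real.rpow_neg hn0.le]
      exact Real.rpow_le_rpow_of_exponent_le hn1 (neg_le_neg this)
    have hMk : ((n : ℝ)⁻¹) ^ M ≤ ∏ i, (if I i = 0 then 1 else (n : ℝ)⁻¹) := by
      rw [hM, ← Finset.prod_pow_eq_pow_sum]
      refine Finset.prod_le_prod (fun i _ => by positivity) fun i _ => ?_
      have h1 := inv_le_one_of_one_le₀ hn1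
      split_ifs with h0
      · exact pow_le_one₀ (by positivity) h1
      · refine pow_le_of_le_one (by positivity) h1 fun h => h0 ?_
        simpa using (ceilDiv_le_iff_le_mul hp0).1 h.le
    calc MvPolynomial.coeff I g ^ 2 = |MvPolynomial.coeff I g| ^ 2 := (sq_abs _).symm
      _ ≤ (K * (n : ℝ) ^ s * (n : ℝ)⁻¹ ^ M) ^ 2 := by gcongr
      _ = K ^ 2 * ((n : ℝ) ^ s) ^ 2 * ((n : ℝ)⁻¹ ^ M * (n : ℝ)⁻¹ ^ M) := by ring
      _ ≤ K ^ 2 * ((n : ℝ) ^ s) ^ 2 *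
          ((n : ℝ) ^ (-s) * ∏ i, (if I i = 0 then 1 else (n : ℝ)⁻¹)) := by gcongr
      _ = _ := by
        rw [Real.rpow_neg hn0.le]
        have : (n : ℝ) ^ s ≠ 0 := (Real.rpow_pos_of_pos hn0 s).ne'
        field_simp
  rw [coeffNorm, Real.sq_sqrt (Finset.sum_nonneg fun _ _ => sq_nonneg _)]
  have hmem : ∀ I ∈ g.support.filter (fun I => (I.sum fun _ e => e) = d), ∑ i, I i = d :=
    fun I hI => by
      rw [← (Finset.mem_filter.1 hI).2, Finsupp.sum_fintype _ _ fun _ => rfl]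
  calc _ ≤ ∑ I ∈ g.support.filter (fun I => (I.sum fun _ e => e) = d),
        K ^ 2 * (n : ℝ) ^ s * ∏ i, (if I i = 0 then 1 else (n : ℝ)⁻¹) :=
        Finset.sum_le_sum fun I hI => hcoeff I (hmem I hI)
    _ ≤ K ^ 2 * (n : ℝ) ^ s * Real.exp d := by
        rw [← Finset.mul_sum]; gcongr; exact sum_prod_ite_inv_le hn d _ hmem
    _ ≤ (K ^ 2 * Real.exp d + 1) * (n : ℝ) ^ s := by
        have : 0 < (n : ℝ) ^ s := Real.rpow_pos_of_pos hn0 s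
        nlinarith
end
end

section
/- Let ρ : ℝ → [0,∞) be an even, log-concave probability density, i.e., ρ(−t) = ρ(t) for all t, ρ(λs + (1−λ)t) ≥ ρ(s)^λ ρ(t)^{1−λ} for all s, t ∈ ℝ and λ ∈ [0,1], and ∫_ℝ ρ(t) dt = 1. Then for all m, k ∈ ℕ: (∫_ℝ t^{m+k} ρ(t) dt)² ≤ (1 − (m−k)²/(m+k+1)²) · (∫_ℝ t^{2m} ρ(t) dt) · (∫_ℝ t^{2k} ρ(t) dt). -/
open MeasureTheory

noncomputable section

/-- An even log-concave function is nonincreasing in `|t|`. -/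
lemma le_of_abs_le_of_even_log_concave {ρ : ℝ → ℝ} (hnn : ∀ t, 0 ≤ ρ t)
    (heven : ∀ t, ρ (-t) = ρ t)
    (hlc : ∀ s t : ℝ, ∀ l : ℝ, 0 ≤ l → l ≤ 1 →
      ρ s ^ l * ρ t ^ (1 - l) ≤ ρ (l * s + (1 - l) * t))
    {s t : ℝ} (hst : |s| ≤ |t|) : ρ t ≤ ρ s := by
  rcases (hnn t).eq_or_lt with h0 | h0
  · exact h0 ▸ hnn s
  have habs : ρ |t| = ρ t := by
    rcases abs_choice t with h | h <;> simp [h, heven]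
  rcases (abs_nonneg t).eq_or_lt with ht | ht
  · have h1 : t = 0 := abs_eq_zero.mp ht.symm
    have h2 : s = 0 := abs_eq_zero.mp (le_antisymm (ht ▸ hst) (abs_nonneg s))
    rw [h1, h2]
  obtain ⟨h1, h2⟩ := abs_le.mp hst
  have key := hlc |t| (-|t|) ((s + |t|) / (2 * |t|)) (div_nonneg (by linarith) (by linarith))
    ((div_le_one (by linarith)).mpr (by linarith))
  rw [heven, habs, ← Real.rpow_add h0, add_sub_cancel, Real.rpow_one] at key
  convert key using 2
  field_simp
  ring

/-- An integrable function nonincreasing in `|t|` takes values below any positive level. -/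
lemma exists_pos_lt_of_integrable {ρ : ℝ → ℝ} (hint : Integrable ρ)
    (hmono : ∀ s t, |s| ≤ |t| → ρ t ≤ ρ s) {c : ℝ} (hc : 0 < c) :
    ∃ T, 0 < T ∧ ρ T < c := by
  by_contra! h
  have hle : ∀ t, c ≤ ρ t := fun t =>
    (h (|t| + 1) (by positivity)).trans
      (hmono _ _ (by rw [abs_of_pos (by positivity : 0 < |t| + 1)]; linarith))
  have hconst : Integrable (fun _ : ℝ => c) :=
    hint.mono' aestronglyMeasurable_const
      (.of_forall fun t => by rw [Real.norm_of_nonneg hc.le]; exact hle t)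
  rw [integrable_const_iff] at hconst
  rcases hconst with h | h
  · exact hc.ne' h
  · simpa using h.measure_univ_lt_top

lemma measurable_of_antitone_abs {ρ : ℝ → ℝ} (hmono : ∀ s t, |s| ≤ |t| → ρ t ≤ ρ s) :
    Measurable ρ := by
  have hanti : Antitone fun x : ℝ => ρ (max x 0) := fun x y hxy => by
    apply hmono
    rw [abs_of_nonneg (le_max_right _ _), abs_of_nonneg (le_max_right _ _)]
    exact max_le_max_right 0 hxy
  have heq : ρ = (fun x : ℝ => ρ (max x 0)) ∘ fun t => |t| := by
    funext t
    exact le_antisymm (hmono _ _ (by simp)) (hmono _ _ (by simp))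
  rw [heq]
  exact hanti.measurable.comp measurable_id.abs

/-- Exponential decay of an integrable even log-concave function. -/
lemma exists_le_exp_neg_mul_abs {ρ : ℝ → ℝ} (hnn : ∀ t, 0 ≤ ρ t)
    (heven : ∀ t, ρ (-t) = ρ t)
    (hlc : ∀ s t : ℝ, ∀ l : ℝ, 0 ≤ l → l ≤ 1 →
      ρ s ^ l * ρ t ^ (1 - l) ≤ ρ (l * s + (1 - l) * t))
    (hint : Integrable ρ) (h0 : 0 < ρ 0) :
    ∃ C c : ℝ, 0 < c ∧ ∀ t, ρ t ≤ C * Real.exp (-c * |t|) := by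
  have hmono : ∀ s t, |s| ≤ |t| → ρ t ≤ ρ s := fun s t =>
    le_of_abs_le_of_even_log_concave hnn heven hlc
  obtain ⟨T, hT, hρT⟩ := exists_pos_lt_of_integrable hint hmono
    (mul_pos h0 (Real.exp_pos (-1)))
  refine ⟨ρ 0 * Real.exp 1, T⁻¹, inv_pos.mpr hT, fun t => ?_⟩
  rw [mul_assoc, ← Real.exp_add]
  have habs : ρ |t| = ρ t := by
    rcases abs_choice t with h | h <;> simp [h, heven]
  rcases le_total |t| T with ht | ht
  · have h1 : T⁻¹ * |t| ≤ 1 := by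
      rw [inv_mul_le_iff₀ hT]; simpa using ht
    calc ρ t ≤ ρ 0 := hmono _ _ (by simp)
      _ ≤ _ := le_mul_of_one_le_right h0.le (Real.one_le_exp (by linarith))
  · have htpos : 0 < |t| := hT.trans_le ht
    suffices h : ρ t ≤ ρ 0 * Real.exp (-(|t| / T)) by
      refine h.trans (mul_le_mul_of_nonneg_left (Real.exp_le_exp.mpr ?_) h0.le)
      rw [div_eq_inv_mul]; linarith
    rcases (hnn t).eq_or_lt with hz | hz
    · rw [← hz]; positivity
    have key := hlc |t| 0 (T / |t|) (by positivity) ((div_le_one htpos).mpr ht)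
    rw [habs, mul_zero, add_zero, div_mul_cancel₀ _ htpos.ne'] at key
    have hlog := Real.log_lt_log (by positivity) (key.trans_lt hρT)
    rw [Real.log_mul (by positivity) (by positivity), Real.log_rpow hz, Real.log_rpow h0,
      Real.log_mul h0.ne' (Real.exp_pos _).ne', Real.log_exp] at hlog
    have h2 : Real.log (ρ t) ≤ Real.log (ρ 0) - |t| / T := by
      have h3 : T / |t| * (Real.log (ρ t) - Real.log (ρ 0)) < -1 := by linarith
      rw [div_mul_eq_mul_div, div_lt_iff₀ htpos] at h3
      have h4 : Real.log (ρ t) - Real.log (ρ 0) ≤ -|t| / T := by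
        rw [le_div_iff₀ hT]; linarith
      rw [neg_div] at h4
      linarith
    rw [← Real.log_le_log_iff hz (by positivity), Real.log_mul h0.ne' (Real.exp_pos _).ne',
      Real.log_exp]
    linarith

/-- All moments of an integrable even log-concave function are finite. -/
lemma integrable_pow_mul_of_even_log_concave {ρ : ℝ → ℝ} (hnn : ∀ t, 0 ≤ ρ t)
    (heven : ∀ t, ρ (-t) = ρ t)
    (hlc : ∀ s t : ℝ, ∀ l : ℝ, 0 ≤ l → l ≤ 1 →
      ρ s ^ l * ρ t ^ (1 - l) ≤ ρ (l * s + (1 - l) * t))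
    (hint : Integrable ρ) (h0 : 0 < ρ 0) (n : ℕ) :
    Integrable fun t => t ^ n * ρ t := by
  obtain ⟨C, c, hc, hle⟩ := exists_le_exp_neg_mul_abs hnn heven hlc hint h0
  have hmeas : Measurable ρ := measurable_of_antitone_abs fun s t =>
    le_of_abs_le_of_even_log_concave hnn heven hlc
  have hexp : Integrable fun t : ℝ => |t| ^ n * Real.exp (-c * |t|) := by
    have hhalf : IntegrableOn (fun t : ℝ => t ^ n * Real.exp (-c * t)) (Set.Ioi 0) := by
      have h := integrableOn_rpow_mul_exp_neg_mul_rpow (s := n) (p := 1)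
        (by linarith [n.cast_nonneg (α := ℝ)]) one_pos hc
      simpa using h
    have hpos : IntegrableOn (fun t : ℝ => |t| ^ n * Real.exp (-c * |t|)) (Set.Ioi 0) :=
      hhalf.congr_fun (fun t ht => by simp only [abs_of_pos (Set.mem_Ioi.mp ht)])
        measurableSet_Ioi
    have hneg : IntegrableOn (fun t : ℝ => |t| ^ n * Real.exp (-c * |t|)) (Set.Iio 0) := by
      rw [← neg_zero] at hpos
      simpa only [abs_neg] using hpos.comp_neg_Iio
    rw [← integrableOn_univ, ← Set.Iic_union_Ioi (a := (0 : ℝ))]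
    exact ((integrableOn_Iic_iff_integrableOn_Iio).mpr hneg).union hpos
  refine (hexp.const_mul C).mono' (by fun_prop) (.of_forall fun t => ?_)
  rw [norm_mul, norm_pow, Real.norm_eq_abs, Real.norm_of_nonneg (hnn t)]
  calc |t| ^ n * ρ t ≤ |t| ^ n * (C * Real.exp (-c * |t|)) := by gcongr; exact hle t
    _ = _ := by ring

/-- Over a positive superlevel set of `ρ`, which is a symmetric interval, a derivative `f` of a
function with `F (-a) ≤ F a` has nonnegative integral. -/
lemma setIntegral_superlevel_nonneg {ρ F f : ℝ → ℝ} (hint : Integrable ρ)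
    (hmono : ∀ s t, |s| ≤ |t| → ρ t ≤ ρ s)
    (hF : ∀ t, HasDerivAt F (f t) t) (hf : Continuous f) (hFle : ∀ a, 0 ≤ a → F (-a) ≤ F a)
    {s : ℝ} (hs : 0 < s) : 0 ≤ ∫ t in {t | s < ρ t}, f t := by
  set S := {t | s < ρ t}
  obtain ⟨T, hT, hρT⟩ := exists_pos_lt_of_integrable hint hmono hs
  have hbdd : BddAbove S := ⟨T, fun t ht => by
    by_contra! h
    exact (hρT.trans ht).not_ge (hmono _ _ (abs_le_abs_of_nonneg hT.le h.le))⟩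
  rcases S.eq_empty_or_nonempty with he | ⟨t₀, ht₀⟩
  · simp [he]
  have habs : ∀ t ∈ S, |t| ∈ S := fun t ht => lt_of_lt_of_le ht (hmono _ _ (by simp))
  have ha : 0 ≤ sSup S := (abs_nonneg t₀).trans (le_csSup hbdd (habs _ ht₀))
  have hsub : S ⊆ Set.Icc (-sSup S) (sSup S) := fun t ht =>
    abs_le.mp (le_csSup hbdd (habs t ht))
  have hsup : Set.Ioo (-sSup S) (sSup S) ⊆ S := fun t ht => by
    obtain ⟨u, hu, htu⟩ := exists_lt_of_lt_csSup ⟨t₀, ht₀⟩ (abs_lt.mpr ht)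
    exact lt_of_lt_of_le hu (hmono _ _ (htu.le.trans (le_abs_self u)))
  have hae : S =ᵐ[volume] Set.Ioc (-sSup S) (sSup S) :=
    (hsub.eventuallyLE.trans Ioc_ae_eq_Icc.symm.le).antisymm
      (Ioo_ae_eq_Ioc.symm.le.trans hsup.eventuallyLE)
  rw [setIntegral_congr_set hae, ← intervalIntegral.integral_of_le (by linarith),
    intervalIntegral.integral_eq_sub_of_hasDerivAt (fun t _ => hF t)
      (hf.intervalIntegrable _ _)]
  linarith [hFle _ ha]

/-- Integrating against a function nonincreasing in `|t|` preserves nonnegativity over symmetric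
intervals (layer-cake decomposition). -/
lemma integral_mul_nonneg_of_antitone_abs {ρ F f : ℝ → ℝ} (hnn : ∀ t, 0 ≤ ρ t)
    (hint : Integrable ρ) (hmono : ∀ s t, |s| ≤ |t| → ρ t ≤ ρ s)
    (hF : ∀ t, HasDerivAt F (f t) t) (hf : Continuous f) (hFle : ∀ a, 0 ≤ a → F (-a) ≤ F a)
    (hfρ : Integrable fun t => f t * ρ t) : 0 ≤ ∫ t, f t * ρ t := by
  have hmeas : Measurable ρ := measurable_of_antitone_abs hmono
  let A : Set (ℝ × ℝ) := {p | 0 < p.2 ∧ p.2 < ρ p.1}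
  have hA : MeasurableSet A :=
    (measurableSet_lt measurable_const measurable_snd).inter
      (measurableSet_lt measurable_snd (hmeas.comp measurable_fst))
  let g : ℝ → ℝ → ℝ := fun t s => A.indicator (fun p => f p.1) (t, s)
  have hslice : ∀ t, g t = (Set.Ioo 0 (ρ t)).indicator fun _ => f t := fun t => rfl
  have hgint : ∀ t, ∫ s, g t s = f t * ρ t := fun t => by
    rw [hslice, integral_indicator measurableSet_Ioo]
    simp [hnn t, mul_comm]
  have hgnorm : ∀ t, ∫ s, ‖g t s‖ = ‖f t * ρ t‖ := fun t => by
    simp_rw [hslice, norm_indicator_eq_indicator_norm]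
    rw [integral_indicator measurableSet_Ioo]
    simp [hnn t, abs_of_nonneg, mul_comm]
  have hprod : Integrable (Function.uncurry g) (volume.prod volume) := by
    have hm : Measurable (Function.uncurry g) :=
      (hf.measurable.comp measurable_fst).indicator hA
    refine (integrable_prod_iff hm.aestronglyMeasurable).mpr ⟨.of_forall fun t => ?_, ?_⟩
    · change Integrable (g t)
      rw [hslice, integrable_indicator_iff measurableSet_Ioo]
      exact integrableOn_const (by simp)
    · exact hfρ.norm.congr (.of_forall fun t => (hgnorm t).symm)
  calc 0 ≤ ∫ s, ∫ t, g t s := integral_nonneg fun s => by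
        rcases le_or_gt s 0 with hs | hs
        · have : ∀ t, g t s = 0 := fun t => Set.indicator_of_notMem (fun h => hs.not_gt h.1) _
          simp [this]
        · have hg : (fun t => g t s) = {t | s < ρ t}.indicator f := by
            funext t
            simp [g, A, Set.indicator, hs]
          change 0 ≤ ∫ t, g t s
          rw [hg, integral_indicator (measurableSet_lt measurable_const hmeas)]
          exact setIntegral_superlevel_nonneg hint hmono hF hf hFle hs
    _ = ∫ t, ∫ s, g t s := (integral_integral_swap hprod).symm
    _ = ∫ t, f t * ρ t := by simp_rw [hgint]

/-- Lemma A.1 (Kosov): for an even log-concave probability density `ρ` on ℝ and all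
`m, k ∈ ℕ`, the squared `(m+k)`-th moment is at most
`(1 - (m-k)²/(m+k+1)²)` times the product of the `2m`-th and `2k`-th moments. -/
theorem moment_inequality_even_log_concave (ρ : ℝ → ℝ)
    (hnn : ∀ t, 0 ≤ ρ t)
    (heven : ∀ t, ρ (-t) = ρ t)
    (hlc : ∀ s t : ℝ, ∀ l : ℝ, 0 ≤ l → l ≤ 1 →
      ρ s ^ l * ρ t ^ (1 - l) ≤ ρ (l * s + (1 - l) * t))
    (hprob : ∫ t, ρ t = 1) (m k : ℕ) :
    (∫ t, t ^ (m + k) * ρ t) ^ 2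
      ≤ (1 - ((m : ℝ) - k) ^ 2 / ((m : ℝ) + k + 1) ^ 2) *
          (∫ t, t ^ (2 * m) * ρ t) * (∫ t, t ^ (2 * k) * ρ t) := by
  have hint : Integrable ρ := .of_integral_ne_zero (by simp [hprob])
  have hmono : ∀ s t, |s| ≤ |t| → ρ t ≤ ρ s := fun s t =>
    le_of_abs_le_of_even_log_concave hnn heven hlc
  have h0 : 0 < ρ 0 := by
    refine (hnn 0).lt_of_ne' fun h => ?_
    have hz : ∀ t, ρ t = 0 := fun t => le_antisymm (h ▸ hmono 0 t (by simp)) (hnn t)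
    simp [hz] at hprob
  have hmom := integrable_pow_mul_of_even_log_concave hnn heven hlc hint h0
  set a := ∫ t, t ^ (2 * m) * ρ t
  set b := ∫ t, t ^ (m + k) * ρ t
  set c := ∫ t, t ^ (2 * k) * ρ t
  have hquad : ∀ x : ℝ, 0 ≤ (2 * k + 1) * c * (x * x) + (-2 * (m + k + 1) * b) * x
      + (2 * m + 1) * a := fun x => by
    let F : ℝ → ℝ := fun t =>
      t ^ (2 * m + 1) - 2 * x * t ^ (m + k + 1) + x ^ 2 * t ^ (2 * k + 1)
    let f : ℝ → ℝ := fun t =>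
      (2 * m + 1) * t ^ (2 * m) - 2 * x * ((m + k + 1) * t ^ (m + k))
        + x ^ 2 * ((2 * k + 1) * t ^ (2 * k))
    have hF : ∀ t, HasDerivAt F (f t) t := fun t => by
      have h := ((hasDerivAt_pow (2 * m + 1) t).fun_sub
        ((hasDerivAt_pow (m + k + 1) t).const_mul (2 * x))).fun_add
        ((hasDerivAt_pow (2 * k + 1) t).const_mul (x ^ 2))
      simpa [F, f] using h
    have hFeq : ∀ t, F t = t * (t ^ m - x * t ^ k) ^ 2 := fun t => by simp only [F]; ring
    have hFle : ∀ t, 0 ≤ t → F (-t) ≤ F t := fun t ht => by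
      rw [hFeq, hFeq]
      exact (mul_nonpos_of_nonpos_of_nonneg (by linarith) (sq_nonneg _)).trans
        (mul_nonneg ht (sq_nonneg _))
    have hsplit : (fun t => f t * ρ t) = fun t =>
        (2 * m + 1) * (t ^ (2 * m) * ρ t) - 2 * x * (m + k + 1) * (t ^ (m + k) * ρ t)
          + x ^ 2 * (2 * k + 1) * (t ^ (2 * k) * ρ t) := by
      funext t; simp only [f]; ring
    have i₁ := (hmom (2 * m)).const_mul (2 * m + 1)
    have i₂ := (hmom (m + k)).const_mul (2 * x * (m + k + 1))
    have i₁₂ : Integrable fun t => (2 * m + 1) * (t ^ (2 * m) * ρ t)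
        - 2 * x * (m + k + 1) * (t ^ (m + k) * ρ t) := i₁.sub i₂
    have i₃ := (hmom (2 * k)).const_mul (x ^ 2 * (2 * k + 1))
    have hnonneg := integral_mul_nonneg_of_antitone_abs hnn hint hmono hF
      (by simp only [f]; fun_prop) hFle (hsplit ▸ i₁₂.add i₃)
    rw [hsplit, integral_add i₁₂ i₃, integral_sub i₁ i₂, integral_const_mul,
      integral_const_mul, integral_const_mul] at hnonneg
    change 0 ≤ (2 * m + 1) * a - 2 * x * (m + k + 1) * b + x ^ 2 * (2 * k + 1) * c at hnonneg
    linarith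
  have hdisc := discrim_le_zero hquad
  rw [discrim] at hdisc
  have hpos : (0 : ℝ) < ((m : ℝ) + k + 1) ^ 2 := by positivity
  rw [one_sub_div hpos.ne', mul_assoc, div_mul_eq_mul_div, le_div_iff₀ hpos]
  linarith
end
end

section
/- There exists a universal constant C ≥ 0 such that for every n ∈ ℕ, every H_n-invariant, isotropic, log-concave probability measure η on ℝ^n, and every degree-2 homogeneous polynomial f : ℝ^n → ℝ with coeff_2(f) = 1: ∫ f² dη ≥ 4/5 − C/n, and Var_η(f) ≥ min( Var_η(x ↦ n^{−1/2} Σ_{i=1}^n x_i²), 4/5 − C/n ). -/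
open MeasureTheory

noncomputable section

/-- A measure on ℝ^n is log-concave if it has a log-concave density w.r.t. Lebesgue measure. -/
def IsLogConcave {n : ℕ} (μ : Measure (Fin n → ℝ)) : Prop :=
  ∃ ρ : (Fin n → ℝ) → ℝ, (∀ x, 0 ≤ ρ x) ∧
    μ = volume.withDensity (fun x => ENNReal.ofReal (ρ x)) ∧
    ∀ x y : Fin n → ℝ, ∀ l : ℝ, 0 ≤ l → l ≤ 1 →
      ρ x ^ l * ρ y ^ (1 - l) ≤ ρ (l • x + (1 - l) • y)

/-- A measure on ℝ^n is `H_n`-invariant if it is invariant under all coordinate permutations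
and all sign changes of the coordinates. -/
def IsHnInvariant {n : ℕ} (μ : Measure (Fin n → ℝ)) : Prop :=
  (∀ σ : Equiv.Perm (Fin n), Measure.map (fun x => x ∘ σ) μ = μ) ∧
  (∀ ε : Fin n → ℝ, (∀ i, ε i = 1 ∨ ε i = -1) →
    Measure.map (fun x i => ε i * x i) μ = μ)

/-- A measure on ℝ^n is isotropic if it is centered with identity covariance. -/
def IsIsotropic {n : ℕ} (μ : Measure (Fin n → ℝ)) : Prop :=
  (∀ i, ∫ x, x i ∂μ = 0) ∧
  (∀ i j, ∫ x, x i * x j ∂μ = if i = j then (1 : ℝ) else 0)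


/-- A nonnegative log-concave function that is invariant under permutations and sign changes of
the coordinates. -/
structure IsSymmetricLogConcave {n : ℕ} (ρ : (Fin n → ℝ) → ℝ) : Prop where
  nonneg : ∀ x, 0 ≤ ρ x
  logConcave : ∀ x y : Fin n → ℝ, ∀ l : ℝ, 0 ≤ l → l ≤ 1 →
    ρ x ^ l * ρ y ^ (1 - l) ≤ ρ (l • x + (1 - l) • y)
  perm : ∀ (σ : Equiv.Perm (Fin n)) (x), ρ (x ∘ σ) = ρ x
  sign : ∀ (ε : Fin n → ℤˣ) (x), ρ (fun i => (ε i : ℝ) * x i) = ρ x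

section Symmetrization

variable {n : ℕ}

lemma convex_superlevel_of_logConcave {ρ : (Fin n → ℝ) → ℝ} (h0 : ∀ x, 0 ≤ ρ x)
    (hlc : ∀ x y : Fin n → ℝ, ∀ l : ℝ, 0 ≤ l → l ≤ 1 →
      ρ x ^ l * ρ y ^ (1 - l) ≤ ρ (l • x + (1 - l) • y)) (s : ℝ) :
    Convex ℝ {x | s ≤ ρ x} := by
  rcases lt_or_ge s 0 with hs | hs
  · have : {x | s ≤ ρ x} = Set.univ := by
      ext x
      simpa using hs.le.trans (h0 x)
    rw [this]
    exact convex_univ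
  · intro x hx y hy a b ha hb hab
    obtain rfl : b = 1 - a := by linarith
    refine le_trans ?_ (hlc x y a ha (by linarith))
    calc s = s ^ a * s ^ (1 - a) := by
          rw [← Real.rpow_add_of_nonneg hs ha hb]; simp
      _ ≤ ρ x ^ a * ρ y ^ (1 - a) :=
          mul_le_mul (Real.rpow_le_rpow hs hx ha) (Real.rpow_le_rpow hs hy hb)
            (Real.rpow_nonneg hs _) (Real.rpow_nonneg (h0 x) _)

lemma aemeasurable_of_logConcave {ρ : (Fin n → ℝ) → ℝ} (h0 : ∀ x, 0 ≤ ρ x)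
    (hlc : ∀ x y : Fin n → ℝ, ∀ l : ℝ, 0 ≤ l → l ≤ 1 →
      ρ x ^ l * ρ y ^ (1 - l) ≤ ρ (l • x + (1 - l) • y)) :
    AEMeasurable ρ volume := by
  refine MeasureTheory.NullMeasurable.aemeasurable ?_
  refine @measurable_of_Ici ℝ (NullMeasurableSpace (Fin n → ℝ) volume) _ _ _ _ _ _ _ _ fun s => ?_
  exact (convex_superlevel_of_logConcave h0 hlc s).nullMeasurableSet volume

lemma withDensity_comp_ae_eq {α : Type*} [MeasurableSpace α] {μ : Measure α} {F : α → ENNReal}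
    (hF : AEMeasurable F μ) (T : α ≃ᵐ α) (hT : MeasurePreserving T μ μ)
    (hfin : ∫⁻ x, F x ∂μ ≠ ⊤)
    (hinv : Measure.map T (μ.withDensity F) = μ.withDensity F) :
    F ∘ T =ᵐ[μ] F := by
  refine ((withDensity_eq_iff hF (hF.comp_quasiMeasurePreserving hT.quasiMeasurePreserving)
    hfin).1 ?_).symm
  ext s hs
  have hs' : MeasurableSet (T.symm ⁻¹' s) := T.symm.measurable hs
  have hss : T ⁻¹' (T.symm ⁻¹' s) = s := by
    ext x; simp
  have h1 := congrArg (fun ν => ν (T.symm ⁻¹' s)) hinv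
  simp only [Measure.map_apply T.measurable hs', hss] at h1
  rw [h1, withDensity_apply _ hs', withDensity_apply _ hs,
    ← hT.setLIntegral_comp_preimage_emb T.measurableEmbedding, hss]
  rfl

/-- The permutation of coordinates `x ↦ x ∘ σ` as a measurable equivalence. -/
def permEquiv (σ : Equiv.Perm (Fin n)) : (Fin n → ℝ) ≃ᵐ (Fin n → ℝ) where
  toFun x := x ∘ σ
  invFun x := x ∘ σ.symm
  left_inv x := by ext; simp
  right_inv x := by ext; simp
  measurable_toFun := by
    refine measurable_pi_lambda _ fun i => ?_
    exact measurable_pi_apply _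
  measurable_invFun := by
    refine measurable_pi_lambda _ fun i => ?_
    exact measurable_pi_apply _

lemma intUnits_cast_mul_self (ε : ℤˣ) : ((ε : ℤ) : ℝ) * ((ε : ℤ) : ℝ) = 1 := by
  rcases Int.units_eq_one_or ε with h | h <;> simp [h]

/-- The coordinatewise multiplication by signs as a measurable equivalence. -/
def signEquiv (ε : Fin n → ℤˣ) : (Fin n → ℝ) ≃ᵐ (Fin n → ℝ) where
  toFun x i := (ε i : ℝ) * x i
  invFun x i := (ε i : ℝ) * x i
  left_inv x := by ext; simp [← mul_assoc, intUnits_cast_mul_self]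
  right_inv x := by ext; simp [← mul_assoc, intUnits_cast_mul_self]
  measurable_toFun := by
    refine measurable_pi_lambda _ fun i => ?_
    exact (measurable_pi_apply i).const_mul _
  measurable_invFun := by
    refine measurable_pi_lambda _ fun i => ?_
    exact (measurable_pi_apply i).const_mul _

lemma measurePreserving_permEquiv (σ : Equiv.Perm (Fin n)) :
    MeasurePreserving (permEquiv σ) volume volume := by
  have := volume_measurePreserving_piCongrLeft (fun _ : Fin n => ℝ) σ.symm
  convert! this using 1
  ext x i
  simp [permEquiv, MeasurableEquiv.piCongrLeft, Equiv.piCongrLeft, Equiv.piCongrLeft']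

lemma measurePreserving_signEquiv (ε : Fin n → ℤˣ) :
    MeasurePreserving (signEquiv ε) volume volume := by
  refine volume_preserving_pi (f := fun i (t : ℝ) => (ε i : ℝ) * t) fun i => ?_
  rcases Int.units_eq_one_or (ε i) with h | h
  · simpa [h] using! MeasurePreserving.id (volume : Measure ℝ)
  · simpa [h] using Measure.measurePreserving_neg (volume : Measure ℝ)

/-- An `H_n`-invariant log-concave probability measure has an exactly invariant log-concave
density. -/
lemma exists_isSymmetricLogConcave {η : Measure (Fin n → ℝ)} [IsProbabilityMeasure η]
    (hinv : IsHnInvariant η) (hlc : IsLogConcave η) :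
    ∃ ρ : (Fin n → ℝ) → ℝ, IsSymmetricLogConcave ρ ∧
      η = volume.withDensity (fun x => ENNReal.ofReal (ρ x)) := by
  obtain ⟨ρ, h0, hη, hρ⟩ := hlc
  have hmeas := aemeasurable_of_logConcave h0 hρ
  have hF : AEMeasurable (fun x => ENNReal.ofReal (ρ x)) volume := hmeas.ennreal_ofReal
  have hfin : ∫⁻ x, ENNReal.ofReal (ρ x) ≠ ⊤ := by
    have : η Set.univ = 1 := measure_univ
    rw [hη, withDensity_apply _ MeasurableSet.univ, Measure.restrict_univ] at this
    simp [this]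
  have key : ∀ T : (Fin n → ℝ) ≃ᵐ (Fin n → ℝ), MeasurePreserving T volume volume →
      Measure.map T η = η → ρ ∘ T =ᵐ[volume] ρ := by
    intro T hT hTη
    rw [hη] at hTη
    filter_upwards [withDensity_comp_ae_eq hF T hT hfin hTη] with x hx
    exact (ENNReal.ofReal_eq_ofReal_iff (h0 _) (h0 _)).1 hx
  have hperm : ∀ σ, ρ ∘ permEquiv σ =ᵐ[volume] ρ := fun σ =>
    key _ (measurePreserving_permEquiv σ) (hinv.1 σ)
  have hsign : ∀ ε, ρ ∘ signEquiv ε =ᵐ[volume] ρ := fun ε =>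
    key _ (measurePreserving_signEquiv ε) (hinv.2 (fun i => (ε i : ℝ)) fun i => by
      rcases Int.units_eq_one_or (ε i) with h | h <;> simp [h])
  let act : Equiv.Perm (Fin n) × (Fin n → ℤˣ) → (Fin n → ℝ) → (Fin n → ℝ) :=
    fun g x i => (g.2 i : ℝ) * x (g.1 i)
  have hact : ∀ g, ρ ∘ act g =ᵐ[volume] ρ := by
    intro g
    have h1 := (measurePreserving_permEquiv g.1).quasiMeasurePreserving.ae_eq_comp (hsign g.2)
    exact h1.trans (hperm g.1)
  have hbdd : ∀ x, BddBelow (Set.range fun g => ρ (act g x)) := fun x =>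
    (Set.finite_range _).bddBelow
  have hn0 : ∀ x, 0 ≤ ⨅ g, ρ (act g x) := fun x => le_ciInf fun g => h0 _
  refine ⟨fun x => ⨅ g, ρ (act g x), ⟨hn0, ?_, ?_, ?_⟩, ?_⟩
  · intro x y l hl0 hl1
    refine le_ciInf fun g => ?_
    have : act g (l • x + (1 - l) • y) = l • act g x + (1 - l) • act g y := by
      ext i
      simp [act]
      ring
    rw [this]
    refine le_trans ?_ (hρ _ _ l hl0 hl1)
    exact mul_le_mul (Real.rpow_le_rpow (hn0 x) (ciInf_le (hbdd x) g) hl0)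
      (Real.rpow_le_rpow (hn0 y) (ciInf_le (hbdd y) g) (by linarith))
      (Real.rpow_nonneg (hn0 y) _) (Real.rpow_nonneg (h0 _) _)
  · intro τ x
    refine Equiv.iInf_congr ((Equiv.mulLeft τ).prodCongr (Equiv.refl _)) fun g => ?_
    congr 1
  · intro δ x
    refine Equiv.iInf_congr ((Equiv.refl _).prodShear fun σ => Equiv.mulRight (δ ∘ σ)) fun g => ?_
    congr 1
    ext i
    simp [act]
    ring
  · rw [hη]
    refine withDensity_congr_ae ?_
    filter_upwards [ae_all_iff.2 hact] with x hx
    have : ∀ g, ρ (act g x) = ρ x := hx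
    simp [this]

end Symmetrization

namespace IsSymmetricLogConcave

variable {n : ℕ} {ρ : (Fin n → ℝ) → ℝ}

lemma convex_superlevel (h : IsSymmetricLogConcave ρ) (s : ℝ) : Convex ℝ {x | s ≤ ρ x} :=
  convex_superlevel_of_logConcave h.nonneg h.logConcave s

lemma aemeasurable (h : IsSymmetricLogConcave ρ) : AEMeasurable ρ volume :=
  aemeasurable_of_logConcave h.nonneg h.logConcave

lemma update_neg (h : IsSymmetricLogConcave ρ) (x : Fin n → ℝ) (i : Fin n) (a : ℝ) :
    ρ (Function.update x i (-a)) = ρ (Function.update x i a) := by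
  rw [← h.sign (Function.update 1 i (-1)) (Function.update x i a)]
  congr 1
  ext j
  rcases eq_or_ne j i with rfl | hj
  · simp
  · simp [hj]

lemma swap (h : IsSymmetricLogConcave ρ) (x : Fin n → ℝ) (i j : Fin n) :
    ρ (x ∘ Equiv.swap i j) = ρ x := h.perm _ _

lemma le_update (h : IsSymmetricLogConcave ρ) (x : Fin n → ℝ) (i : Fin n) {a : ℝ}
    (ha : |a| ≤ |x i|) : ρ x ≤ ρ (Function.update x i a) := by
  have hx : x ∈ {y | ρ x ≤ ρ y} := le_refl (ρ x)
  have hx' : Function.update x i (-x i) ∈ {y | ρ x ≤ ρ y} := by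
    have := h.update_neg x i (x i)
    simp only [Function.update_eq_self] at this
    exact this.ge
  have hseg : Function.update x i a ∈ segment ℝ x (Function.update x i (-x i)) := by
    rcases eq_or_ne (x i) 0 with h0 | h0
    · have : a = x i := by simpa [h0] using ha
      rw [this, Function.update_eq_self]
      exact left_mem_segment ℝ _ _
    · have hb : |a / x i| ≤ 1 := by
        rw [abs_div]
        exact div_le_one_of_le₀ ha (abs_nonneg _)
      rw [abs_le] at hb
      refine ⟨(1 + a / x i) / 2, (1 - a / x i) / 2, by linarith, by linarith, by ring, ?_⟩
      ext j
      rcases eq_or_ne j i with rfl | hj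
      · simp
        field_simp
        ring
      · simp [hj]
        ring
  exact (h.convex_superlevel (ρ x)).segment_subset hx hx' hseg

lemma anti (h : IsSymmetricLogConcave ρ) {x y : Fin n → ℝ} (hxy : ∀ i, |x i| ≤ |y i|) :
    ρ y ≤ ρ x := by
  have key : ∀ s : Finset (Fin n), ρ y ≤ ρ (s.piecewise x y) := by
    intro s
    induction s using Finset.induction_on with
    | empty => simp
    | insert i s hi ih =>
      rw [Finset.piecewise_insert]
      refine ih.trans (h.le_update _ i ?_)
      simpa [hi] using hxy i
  simpa using key Finset.univ

lemma le_zero (h : IsSymmetricLogConcave ρ) (x : Fin n → ℝ) : ρ x ≤ ρ 0 :=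
  h.anti (by simp)

lemma mul_zero_le (h : IsSymmetricLogConcave ρ) (x : Fin n → ℝ) :
    ρ x * ρ 0 ≤ ρ ((2⁻¹ : ℝ) • x) ^ 2 := by
  have h1 := h.logConcave x 0 2⁻¹ (by norm_num) (by norm_num)
  rw [smul_zero, add_zero, show (1 : ℝ) - 2⁻¹ = 2⁻¹ by norm_num,
    ← Real.mul_rpow (h.nonneg _) (h.nonneg _)] at h1
  have h2 : 0 ≤ ρ x * ρ 0 := mul_nonneg (h.nonneg _) (h.nonneg _)
  calc ρ x * ρ 0 = ((ρ x * ρ 0) ^ (2⁻¹ : ℝ)) ^ 2 := by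
        rw [← Real.rpow_natCast, ← Real.rpow_mul h2]; norm_num
    _ ≤ _ := pow_le_pow_left₀ (Real.rpow_nonneg h2 _) h1 2

/-- The cross-polytope spanned by `|x i|` times the unit vectors lies in the superlevel set of
`ρ` through `x`. -/
lemma le_of_mul_abs_le (h : IsSymmetricLogConcave ρ) (x u : Fin n → ℝ) (i : Fin n)
    (hu : ∀ j, n * |u j| ≤ |x i|) : ρ x ≤ ρ u := by
  have hn : (n : ℝ) ≠ 0 := by
    have := i.pos
    positivity
  have hmem : ∀ j, (Pi.single j (n * u j) : Fin n → ℝ) ∈ {y | ρ x ≤ ρ y} := by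
    intro j
    change ρ x ≤ ρ _
    rw [← h.perm (Equiv.swap i j) (Pi.single j (n * u j) : Fin n → ℝ)]
    refine h.anti fun k => ?_
    rcases eq_or_ne k i with rfl | hk
    · simpa [abs_mul] using hu j
    · have : Equiv.swap i j k ≠ j := by
        intro hc
        apply hk
        rw [Equiv.swap_apply_eq_iff] at hc
        simpa using hc
      simp [this]
  have := (h.convex_superlevel (ρ x)).sum_mem (t := Finset.univ) (w := fun _ : Fin n => (n : ℝ)⁻¹)
    (fun _ _ => by positivity) (by simp [hn]) (fun j _ => hmem j)
  have hsum : ∑ j, (n : ℝ)⁻¹ • (Pi.single j (n * u j) : Fin n → ℝ) = u := by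
    ext j
    simp [Finset.sum_apply, Pi.single_apply, hn]
  rwa [hsum] at this

end IsSymmetricLogConcave

namespace IsSymmetricLogConcave

variable {n : ℕ} {ρ : (Fin n → ℝ) → ℝ}

lemma mul_pow_le_integral (h : IsSymmetricLogConcave ρ) (hint : Integrable ρ) (x : Fin n → ℝ)
    (i : Fin n) : (|x i| / n) ^ n * ρ x ≤ ∫ y, ρ y := by
  have hn : (0 : ℝ) < n := by
    have := i.pos
    exact_mod_cast this
  have hr : 0 ≤ |x i| / n := by positivity
  set r := |x i| / n with hrdef
  set S : Set (Fin n → ℝ) := Set.Icc 0 fun _ => r with hS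
  have hvol : volume.real S = r ^ n := by
    rw [measureReal_def, hS, Real.volume_Icc_pi]
    simp [hr]
  calc r ^ n * ρ x = ∫ _ in S, ρ x := by
        rw [setIntegral_const, hvol, smul_eq_mul]
    _ ≤ ∫ y in S, ρ y := by
        refine setIntegral_mono_on ?_ hint.integrableOn measurableSet_Icc ?_
        · exact integrableOn_const (by rw [hS]; exact isCompact_Icc.measure_lt_top.ne)
        · intro u hu
          refine h.le_of_mul_abs_le x u i fun j => ?_
          rw [abs_of_nonneg (hu.1 j), mul_comm, ← le_div_iff₀ hn]
          exact hu.2 j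
    _ ≤ ∫ y, ρ y := setIntegral_le_integral hint (Filter.Eventually.of_forall h.nonneg)

lemma sq_mul_le (h : IsSymmetricLogConcave ρ) (hint : Integrable ρ) (hn : 2 ≤ n)
    (x : Fin n → ℝ) (i : Fin n) : x i ^ 2 * ρ x ≤ n ^ 2 * (ρ 0 + ∫ y, ρ y) := by
  have hn' : (0 : ℝ) < n := by
    have := i.pos
    exact_mod_cast this
  have hM : 0 ≤ ∫ y, ρ y := integral_nonneg h.nonneg
  have hr : 0 ≤ |x i| / n := by positivity
  have hxi : x i ^ 2 = n ^ 2 * (|x i| / n) ^ 2 := by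
    field_simp
    simp
  rw [hxi, mul_assoc]
  refine mul_le_mul_of_nonneg_left ?_ (by positivity)
  rcases le_total (|x i| / n) 1 with h1 | h1
  · have : (|x i| / n) ^ 2 * ρ x ≤ 1 * ρ 0 :=
      mul_le_mul (pow_le_one₀ hr h1) (h.le_zero x) (h.nonneg x) zero_le_one
    linarith
  · have h2 := mul_le_mul_of_nonneg_right (pow_le_pow_right₀ h1 hn) (h.nonneg x)
    linarith [h.mul_pow_le_integral hint x i, h.nonneg 0]

lemma integrable_fourth_moment (h : IsSymmetricLogConcave ρ) (hint : Integrable ρ) (hn : 2 ≤ n)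
    (i : Fin n) (hsq : Integrable fun x => x i ^ 2 * ρ x) :
    Integrable fun x => x i ^ 4 * ρ x := by
  have hmeas : AEStronglyMeasurable (fun x : Fin n → ℝ => x i ^ 4 * ρ x) volume :=
    (((measurable_pi_apply i).pow_const 4).aemeasurable.mul h.aemeasurable).aestronglyMeasurable
  rcases (h.nonneg 0).eq_or_lt with h0 | h0
  · have : (fun x : Fin n → ℝ => x i ^ 4 * ρ x) = fun _ => 0 := by
      ext x
      rw [le_antisymm ((h.le_zero x).trans h0.ge) (h.nonneg x), mul_zero]
    rw [this]
    exact integrable_zero _ _ _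
  · set C := (n : ℝ) ^ 2 * (ρ 0 + ∫ y, ρ y)
    have h2 := (hsq.comp_smul (R := (2⁻¹ : ℝ)) (by norm_num)).const_mul (16 * C / ρ 0)
    refine h2.mono' hmeas (Filter.Eventually.of_forall fun x => ?_)
    rw [Real.norm_of_nonneg (by have := h.nonneg x; positivity)]
    have h3 := h.mul_zero_le x
    have h4 := h.sq_mul_le hint hn ((2⁻¹ : ℝ) • x) i
    have h5 : 0 ≤ ρ ((2⁻¹ : ℝ) • x) := h.nonneg _
    set z := ρ ((2⁻¹ : ℝ) • x)
    simp only [Pi.smul_apply, smul_eq_mul] at h4 ⊢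
    rw [div_mul_eq_mul_div, le_div_iff₀ h0]
    calc x i ^ 4 * ρ x * ρ 0 = x i ^ 4 * (ρ x * ρ 0) := by ring
      _ ≤ x i ^ 4 * z ^ 2 := by gcongr
      _ = 16 * (((2⁻¹ * x i) ^ 2 * z) * ((2⁻¹ * x i) ^ 2 * z)) := by ring
      _ ≤ 16 * (C * ((2⁻¹ * x i) ^ 2 * z)) := by gcongr
      _ = _ := by ring

end IsSymmetricLogConcave

namespace IsSymmetricLogConcave

variable {n : ℕ} {ρ : (Fin n → ℝ) → ℝ}

/-- The linear map sending `(x i, x j)` to `(x i / 4, (2 * x i + x j) / 4)` and fixing the other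
coordinates. -/
def shearMatrix (i j : Fin n) : Matrix (Fin n) (Fin n) ℝ :=
  Matrix.diagonal (fun k => (if k = i then 4⁻¹ else 1) * (if k = j then 4⁻¹ else 1)) *
    Matrix.transvection j i 2

lemma shearMatrix_det {i j : Fin n} (hij : i ≠ j) : (shearMatrix i j).det = 16⁻¹ := by
  rw [shearMatrix, Matrix.det_mul, Matrix.det_transvection_of_ne _ _ hij.symm, Matrix.det_diagonal,
    Finset.prod_mul_distrib]
  simp
  norm_num

lemma shearMatrix_apply {i j : Fin n} (x : Fin n → ℝ) (k : Fin n) :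
    Matrix.toLin' (shearMatrix i j) x k =
      (if k = i then 4⁻¹ else 1) * (if k = j then 4⁻¹ else 1) *
        (x k + if k = j then 2 * x i else 0) := by
  rw [shearMatrix, Matrix.toLin'_mul, LinearMap.comp_apply, Matrix.toLin'_apply,
    Matrix.mulVec_diagonal, Matrix.toLin'_apply, Matrix.transvection, Matrix.add_mulVec,
    Matrix.one_mulVec, Matrix.single_mulVec]
  congr 1
  simp [Function.update_apply]

lemma map_shearMatrix {i j : Fin n} (hij : i ≠ j) :
    Measure.map (Matrix.toLin' (shearMatrix i j)) volume = (16 : ENNReal) • volume := by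
  rw [Real.map_matrix_volume_pi_eq_smul_volume_pi (by rw [shearMatrix_det hij]; norm_num),
    shearMatrix_det hij]
  norm_num

lemma le_shear (h : IsSymmetricLogConcave ρ) {i j : Fin n} (hij : i ≠ j) (x : Fin n → ℝ)
    (hx : |x j| ≤ |x i|) : ρ x ≤ ρ (Matrix.toLin' (shearMatrix i j) x) := by
  set p := Function.update x j 0 with hp
  have hp1 : p ∈ {y | ρ x ≤ ρ y} := h.le_update x j (by simp)
  have hp2 : p ∘ Equiv.swap i j ∈ {y | ρ x ≤ ρ y} := by
    change ρ x ≤ _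
    rw [h.swap]
    exact hp1
  have hz := h.convex_superlevel (ρ x) hp1 hp2 (a := 4⁻¹) (b := 3 / 4) (by norm_num) (by norm_num)
    (by norm_num)
  refine le_trans hz (h.anti fun k => ?_)
  rw [shearMatrix_apply]
  simp only [Pi.add_apply, Pi.smul_apply, smul_eq_mul, Function.comp_apply]
  rcases eq_or_ne k i with rfl | hki
  · simp [hp, hij]
  rcases eq_or_ne k j with rfl | hkj
  · simp [hp, hij, hij.symm, abs_mul]
    have := abs_add_le (x k) (2 * x i)
    rw [abs_mul, abs_two] at this
    have h34 : |(3 : ℝ) / 4| = 3 / 4 := abs_of_pos (by norm_num)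
    linarith
  · rw [Equiv.swap_apply_of_ne_of_ne hki hkj]
    simp only [hki, hkj, hp, if_false, Function.update_of_ne hkj]
    refine le_of_eq ?_
    congr 1
    ring

lemma pow_four_mul_le_shear (h : IsSymmetricLogConcave ρ) {i j : Fin n} (hij : i ≠ j)
    (x : Fin n → ℝ) (hx : |x j| ≤ |x i|) :
    x i ^ 4 * ρ x ≤ 256 *
      ((Matrix.toLin' (shearMatrix i j) x i) ^ 2 * (Matrix.toLin' (shearMatrix i j) x j) ^ 2 *
        ρ (Matrix.toLin' (shearMatrix i j) x)) := by
  have h1 := h.le_shear hij x hx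
  have h2 : x i ^ 2 ≤ (x j + 2 * x i) ^ 2 := by
    rw [sq_le_sq]
    have := abs_sub (x j + 2 * x i) (x j)
    rw [add_sub_cancel_left, abs_mul, abs_two] at this
    linarith
  have h3 := h.nonneg x
  have e1 : Matrix.toLin' (shearMatrix i j) x i = 4⁻¹ * x i := by
    rw [shearMatrix_apply]; simp [hij]
  have e2 : Matrix.toLin' (shearMatrix i j) x j = 4⁻¹ * (x j + 2 * x i) := by
    rw [shearMatrix_apply]; simp [hij.symm]
  rw [e1, e2]
  set z := ρ (Matrix.toLin' (shearMatrix i j) x)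
  calc x i ^ 4 * ρ x = x i ^ 2 * x i ^ 2 * ρ x := by ring
    _ ≤ x i ^ 2 * (x j + 2 * x i) ^ 2 * z := by gcongr
    _ = _ := by ring

lemma integrable_comp_shear {g : (Fin n → ℝ) → ℝ} (hg : Integrable g) {i j : Fin n}
    (hij : i ≠ j) : Integrable (fun x => g (Matrix.toLin' (shearMatrix i j) x)) ∧
      ∫ x, g (Matrix.toLin' (shearMatrix i j) x) = 16 * ∫ x, g x := by
  have hL : AEMeasurable (Matrix.toLin' (shearMatrix i j)) (volume : Measure (Fin n → ℝ)) :=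
    (LinearMap.continuous_on_pi _).measurable.aemeasurable
  have hmap : Integrable g (Measure.map (Matrix.toLin' (shearMatrix i j)) volume) := by
    rw [map_shearMatrix hij]
    exact hg.smul_measure (by norm_num)
  refine ⟨hmap.comp_aemeasurable hL, ?_⟩
  rw [← integral_map hL hmap.aestronglyMeasurable, map_shearMatrix hij, integral_smul_measure]
  simp

/-- The fourth moment of a coordinate is controlled by the mixed moment of two coordinates. -/
lemma fourth_moment_le (h : IsSymmetricLogConcave ρ) {i j : Fin n} (hij : i ≠ j)
    (h4 : Integrable fun x => x i ^ 4 * ρ x)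
    (h22 : Integrable fun x => x i ^ 2 * x j ^ 2 * ρ x) :
    ∫ x, x i ^ 4 * ρ x ≤ 8192 * ∫ x, x i ^ 2 * x j ^ 2 * ρ x := by
  set g : (Fin n → ℝ) → ℝ := fun x => x i ^ 2 * x j ^ 2 * ρ x with hg
  have hg0 : ∀ x, 0 ≤ g x := fun x => mul_nonneg (by positivity) (h.nonneg x)
  obtain ⟨i1, e1⟩ := integrable_comp_shear h22 hij
  obtain ⟨i2, e2⟩ := integrable_comp_shear h22 hij.symm
  calc ∫ x, x i ^ 4 * ρ x ≤ ∫ x, 256 * (g (Matrix.toLin' (shearMatrix i j) x) +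
        g (Matrix.toLin' (shearMatrix j i) x)) := by
        refine integral_mono h4 ((i1.add i2).const_mul 256) fun x => ?_
        have n1 := hg0 (Matrix.toLin' (shearMatrix i j) x)
        have n2 := hg0 (Matrix.toLin' (shearMatrix j i) x)
        rcases le_total |x j| |x i| with hx | hx
        · have : x i ^ 4 * ρ x ≤ 256 * g (Matrix.toLin' (shearMatrix i j) x) :=
            h.pow_four_mul_le_shear hij x hx
          change x i ^ 4 * ρ x ≤ _
          linarith
        · have h1 : x j ^ 4 * ρ x ≤ 256 * g (Matrix.toLin' (shearMatrix j i) x) := by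
            rw [hg]
            simp only
            rw [mul_comm (_ ^ 2)]
            exact h.pow_four_mul_le_shear hij.symm x hx
          have h2 : x i ^ 4 * ρ x ≤ x j ^ 4 * ρ x := by
            refine mul_le_mul_of_nonneg_right ?_ (h.nonneg x)
            have := pow_le_pow_left₀ (abs_nonneg _) hx 4
            rwa [Even.pow_abs (by decide), Even.pow_abs (by decide)] at this
          change x i ^ 4 * ρ x ≤ _
          linarith
    _ = 8192 * ∫ x, g x := by
        rw [integral_const_mul, integral_add i1 i2, e1, e2]
        ring

end IsSymmetricLogConcave

section MonotoneWeight

open Set Filter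

lemma setIntegral_superlevel_nonneg_s17 {h ψ : ℝ → ℝ} (hψ : Antitone ψ)
    (hh : ∀ T, 0 ≤ T → 0 ≤ ∫ a in (0 : ℝ)..T, h a) (s : ℝ) :
    0 ≤ ∫ a in Ioi 0, if s < ψ a then h a else 0 := by
  have hmeas : MeasurableSet {a | s < ψ a} := measurableSet_lt measurable_const hψ.measurable
  have hind : (fun a => if s < ψ a then h a else 0) = {a | s < ψ a}.indicator h := by
    ext a
    simp [indicator_apply]
  rw [hind, setIntegral_indicator hmeas]
  set E := Ioi (0 : ℝ) ∩ {a | s < ψ a} with hE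
  by_cases hb : BddAbove E
  · rcases E.eq_empty_or_nonempty with hemp | hne
    · simp [hemp]
    · set T := sSup E with hT
      have hT0 : 0 ≤ T := by
        obtain ⟨a, ha⟩ := hne
        exact (le_of_lt ha.1).trans (le_csSup hb ha)
      have hsub : E ⊆ Ioc 0 T := fun a ha => ⟨ha.1, le_csSup hb ha⟩
      have hsup : Ioo 0 T ⊆ E := fun a ha => by
        obtain ⟨b, hbE, hab⟩ := exists_lt_of_lt_csSup hne ha.2
        exact ⟨ha.1, lt_of_lt_of_le hbE.2 (hψ hab.le)⟩
      have hae : E =ᵐ[volume] Ioc 0 T := by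
        refine LE.le.eventuallyLE hsub |>.antisymm ?_
        exact Ioo_ae_eq_Ioc.symm.le.trans (LE.le.eventuallyLE hsup)
      rw [setIntegral_congr_set hae, ← intervalIntegral.integral_of_le hT0]
      exact hh T hT0
  · have hEq : E = Ioi 0 := by
      refine Subset.antisymm inter_subset_left fun a ha => ⟨ha, ?_⟩
      rw [not_bddAbove_iff] at hb
      obtain ⟨b, hbE, hab⟩ := hb a
      exact lt_of_lt_of_le hbE.2 (hψ hab.le)
    rw [hEq]
    by_cases hint : IntegrableOn h (Ioi 0)
    · exact ge_of_tendsto (intervalIntegral_tendsto_integral_Ioi 0 hint tendsto_id)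
        ((eventually_ge_atTop 0).mono fun T hT => hh T hT)
    · rw [integral_undef hint]

lemma setIntegral_mul_antitone_nonneg {h ψ : ℝ → ℝ} (hψ : Antitone ψ) (hψ0 : ∀ a, 0 ≤ ψ a)
    (hm : Measurable h) (hh : ∀ T, 0 ≤ T → 0 ≤ ∫ a in (0 : ℝ)..T, h a) :
    0 ≤ ∫ a in Ioi 0, h a * ψ a := by
  by_cases hint : IntegrableOn (fun a => h a * ψ a) (Ioi 0)
  swap
  · rw [integral_undef hint]
  have hψm := hψ.measurable
  have hslice : ∀ f : ℝ → ℝ, ∀ a, ∫ s in Ioi 0, (if s < ψ a then f a else 0) = f a * ψ a := by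
    intro f a
    have : (fun s => if s < ψ a then f a else 0) = (Iio (ψ a)).indicator fun _ => f a := by
      ext s
      simp [indicator_apply]
    rw [this, setIntegral_indicator measurableSet_Iio, setIntegral_const, Ioi_inter_Iio,
      Real.volume_real_Ioo_of_le (hψ0 a)]
    simp [mul_comm]
  have hG : Measurable fun p : ℝ × ℝ => if p.2 < ψ p.1 then h p.1 else 0 :=
    Measurable.ite (measurableSet_lt measurable_snd (hψm.comp measurable_fst))
      (hm.comp measurable_fst) measurable_const
  have hprod : Integrable (fun p : ℝ × ℝ => if p.2 < ψ p.1 then h p.1 else 0)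
      ((volume.restrict (Ioi 0)).prod (volume.restrict (Ioi 0))) := by
    rw [integrable_prod_iff hG.aestronglyMeasurable]
    refine ⟨Eventually.of_forall fun a => ?_, ?_⟩
    · have : (fun s => if s < ψ a then h a else 0) = (Iio (ψ a)).indicator fun _ => h a := by
        ext s
        simp [indicator_apply]
      simp only [this]
      rw [integrable_indicator_iff measurableSet_Iio]
      refine integrableOn_const ?_
      rw [Measure.restrict_apply measurableSet_Iio, inter_comm, Ioi_inter_Iio]
      simp
    · refine hint.norm.congr (Eventually.of_forall fun a => ?_)
      simp only [apply_ite norm, norm_zero, norm_mul]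
      rw [hslice (fun a => ‖h a‖) a, Real.norm_of_nonneg (hψ0 a)]
  calc 0 ≤ ∫ s in Ioi 0, ∫ a in Ioi 0, (if s < ψ a then h a else 0) :=
        integral_nonneg fun s => setIntegral_superlevel_nonneg_s17 hψ hh s
    _ = ∫ a in Ioi 0, ∫ s in Ioi 0, (if s < ψ a then h a else 0) :=
        (integral_integral_swap hprod).symm
    _ = ∫ a in Ioi 0, h a * ψ a := by simp only [hslice h]

/-- If `h` has nonnegative primitive on the half-line, then the even extension of `h` has
nonnegative integral against every even function that decreases on the half-line. -/
lemma integral_comp_abs_mul_nonneg {h φ : ℝ → ℝ} (hφ : ∀ a b, |a| ≤ |b| → φ b ≤ φ a)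
    (hφ0 : ∀ a, 0 ≤ φ a) (hm : Measurable h)
    (hh : ∀ T, 0 ≤ T → 0 ≤ ∫ a in (0 : ℝ)..T, h a) :
    0 ≤ ∫ a, h |a| * φ a := by
  have habs : ∀ a, φ |a| = φ a := fun a =>
    le_antisymm (hφ _ _ (by simp)) (hφ _ _ (by simp))
  have hanti : Antitone fun a => φ (max a 0) := fun a b hab =>
    hφ _ _ (by
      rw [abs_of_nonneg (le_max_right _ _), abs_of_nonneg (le_max_right _ _)]
      exact max_le_max_right 0 hab)
  have h1 := setIntegral_mul_antitone_nonneg hanti (fun _ => hφ0 _) hm hh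
  have h2 : ∫ a, h |a| * φ a = 2 * ∫ a in Ioi 0, h a * φ a := by
    rw [← integral_comp_abs (f := fun a => h a * φ a)]
    simp only [habs]
  rw [h2, setIntegral_congr_fun (g := fun a => h a * φ (max a 0)) measurableSet_Ioi]
  · linarith
  · intro a ha
    simp only [max_eq_left (le_of_lt (mem_Ioi.1 ha))]

end MonotoneWeight

section DefectKernel

open Set

/-- The inner branch of `defectKernel`, used where `|a| ≤ |b|`. -/
def defectKernelIn (b a : ℝ) : ℝ :=
  4 / 45 * (b ^ 2 - 3) ^ 2 + (b ^ 2 - 3 * a ^ 2) * (7 * b ^ 2 / 15 + 8 / 15 - a ^ 2 / 5) +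
    (b ^ 2 - a ^ 2) * (-2 * a ^ 2 / 5)

/-- The outer branch of `defectKernel`, used where `|b| < |a|`. -/
def defectKernelOut (a : ℝ) : ℝ := 4 / 45 * (5 * a ^ 4 - 18 * a ^ 2 + 9)

/-- A kernel with nonnegative primitive in `a` whose symmetrization is bounded by
`(a ^ 2 - b ^ 2) ^ 2 - 8 / 5 * (a ^ 2 + b ^ 2) + 8 / 5`. -/
def defectKernel (b a : ℝ) : ℝ :=
  if |a| ≤ |b| then defectKernelIn b a else defectKernelOut a

lemma defectKernel_abs (b a : ℝ) : defectKernel b |a| = defectKernel b a := by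
  simp [defectKernel, defectKernelIn, defectKernelOut, Even.pow_abs (by decide : Even 4)]

lemma defectKernel_add_le (a b : ℝ) :
    defectKernel b a + defectKernel a b ≤
      (a ^ 2 - b ^ 2) ^ 2 - 8 / 5 * (a ^ 2 + b ^ 2) + 8 / 5 := by
  unfold defectKernel
  rcases lt_trichotomy |a| |b| with hab | hab | hab
  · rw [if_pos hab.le, if_neg hab.not_ge, defectKernelIn, defectKernelOut]
    exact le_of_eq (by ring)
  · have h2 : a ^ 2 = b ^ 2 := sq_eq_sq_iff_abs_eq_abs _ _ |>.2 hab
    rw [if_pos hab.le, if_pos hab.ge, defectKernelIn, defectKernelIn, h2]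
    nlinarith [sq_nonneg (b ^ 2)]
  · rw [if_neg hab.not_ge, if_pos hab.le, defectKernelIn, defectKernelOut]
    exact le_of_eq (by ring)

lemma measurable_defectKernel : Measurable fun p : ℝ × ℝ => defectKernel p.1 p.2 := by
  unfold defectKernel defectKernelIn defectKernelOut
  refine Measurable.ite (measurableSet_le (by fun_prop) (by fun_prop)) ?_ ?_ <;> fun_prop

lemma abs_defectKernel_le (b a : ℝ) : |defectKernel b a| ≤ 10 * (1 + a ^ 4 + b ^ 4) := by
  have ha := sq_nonneg (a ^ 2 - 1)
  have hb := sq_nonneg (b ^ 2 - 1)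
  have hab := sq_nonneg (a ^ 2 - b ^ 2)
  have hab' := mul_nonneg (sq_nonneg a) (sq_nonneg b)
  have ha0 := sq_nonneg a
  have hb0 := sq_nonneg b
  have ha4 := sq_nonneg (a ^ 2)
  have hb4 := sq_nonneg (b ^ 2)
  unfold defectKernel
  split_ifs
  · rw [defectKernelIn, abs_le]
    constructor <;> nlinarith
  · rw [defectKernelOut, abs_le]
    constructor <;> nlinarith

lemma integral_defectKernelIn (b s t : ℝ) :
    ∫ a in s..t, defectKernelIn b a =
      (4 / 45 * (b ^ 2 - 3) ^ 2 * t + t * (b ^ 2 - t ^ 2) * (7 * b ^ 2 / 15 + 8 / 15 - t ^ 2 / 5)) -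
      (4 / 45 * (b ^ 2 - 3) ^ 2 * s + s * (b ^ 2 - s ^ 2) * (7 * b ^ 2 / 15 + 8 / 15 - s ^ 2 / 5)) := by
  refine intervalIntegral.integral_eq_sub_of_hasDerivAt (f := fun t => 4 / 45 * (b ^ 2 - 3) ^ 2 * t +
    t * (b ^ 2 - t ^ 2) * (7 * b ^ 2 / 15 + 8 / 15 - t ^ 2 / 5)) (fun x _ => ?_) ?_
  · have h2 : HasDerivAt (fun t : ℝ => t ^ 2) (2 * x) x := by simpa using hasDerivAt_pow 2 x
    convert! ((hasDerivAt_id x).const_mul (4 / 45 * (b ^ 2 - 3) ^ 2)).add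
      (((hasDerivAt_id x).mul (h2.const_sub (b ^ 2))).mul
        ((h2.div_const 5).const_sub (7 * b ^ 2 / 15 + 8 / 15))) using 1
    simp only [defectKernelIn, id, Pi.mul_apply]
    ring
  · unfold defectKernelIn
    exact Continuous.intervalIntegrable (by fun_prop) _ _

lemma integral_defectKernelOut (s t : ℝ) :
    ∫ a in s..t, defectKernelOut a =
      4 / 45 * (t ^ 2 - 3) ^ 2 * t - 4 / 45 * (s ^ 2 - 3) ^ 2 * s := by
  refine intervalIntegral.integral_eq_sub_of_hasDerivAt
    (f := fun t => 4 / 45 * (t ^ 2 - 3) ^ 2 * t) (fun x _ => ?_) ?_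
  · have h2 : HasDerivAt (fun t : ℝ => t ^ 2) (2 * x) x := by simpa using hasDerivAt_pow 2 x
    convert! (((h2.sub_const 3).pow 2).const_mul (4 / 45)).mul (hasDerivAt_id x) using 1
    simp only [defectKernelOut, id, Pi.pow_apply]
    ring
  · unfold defectKernelOut
    exact Continuous.intervalIntegrable (by fun_prop) _ _

lemma integral_defectKernel_nonneg (b : ℝ) {T : ℝ} (hT : 0 ≤ T) :
    0 ≤ ∫ a in (0 : ℝ)..T, defectKernel b a := by
  have hin : ∀ S, 0 ≤ S → S ≤ |b| →
      ∫ a in (0 : ℝ)..S, defectKernel b a = ∫ a in (0 : ℝ)..S, defectKernelIn b a := by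
    intro S hS hSb
    refine intervalIntegral.integral_congr fun a ha => ?_
    rw [uIcc_of_le hS] at ha
    exact if_pos (by rw [abs_of_nonneg ha.1]; exact ha.2.trans hSb)
  rcases le_or_gt T |b| with hTb | hTb
  · rw [hin T hT hTb, integral_defectKernelIn]
    have h1 : T ^ 2 ≤ b ^ 2 := by
      rw [← sq_abs b]
      exact pow_le_pow_left₀ hT hTb 2
    have h2 := mul_nonneg (mul_nonneg hT (sub_nonneg.2 h1))
      (by nlinarith [sq_nonneg b] : 0 ≤ 7 * b ^ 2 / 15 + 8 / 15 - T ^ 2 / 5)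
    have h3 := mul_nonneg (mul_nonneg (by norm_num : (0 : ℝ) ≤ 4 / 45) (sq_nonneg (b ^ 2 - 3))) hT
    linarith
  · have hint : ∀ s t, IntervalIntegrable (defectKernel b) volume s t := by
      intro s t
      have hdom : IntervalIntegrable (fun a => 10 * (1 + a ^ 4 + b ^ 4)) volume s t :=
        Continuous.intervalIntegrable (by fun_prop) _ _
      refine hdom.mono_fun ?_ (Filter.Eventually.of_forall fun a => ?_)
      · exact (measurable_defectKernel.comp measurable_prodMk_left).aestronglyMeasurable
      · exact (abs_defectKernel_le b a).trans (le_abs_self _)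
    have hout : ∫ a in |b|..T, defectKernel b a = ∫ a in |b|..T, defectKernelOut a := by
      rw [intervalIntegral.integral_of_le hTb.le, intervalIntegral.integral_of_le hTb.le]
      refine setIntegral_congr_fun measurableSet_Ioc fun a ha => ?_
      exact if_neg (not_le.2 (ha.1.trans_le (le_abs_self a)))
    rw [← intervalIntegral.integral_add_adjacent_intervals (hint 0 |b|) (hint |b| T),
      hin _ (abs_nonneg b) le_rfl, hout, integral_defectKernelIn, integral_defectKernelOut, sq_abs]
    have h3 := mul_nonneg (mul_nonneg (by norm_num : (0 : ℝ) ≤ 4 / 45) (sq_nonneg (T ^ 2 - 3))) hT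
    linarith

end DefectKernel

namespace IsSymmetricLogConcave

section Defect

variable {n : ℕ} {ρ : (Fin n → ℝ) → ℝ}

lemma integrable_defectKernel (h : IsSymmetricLogConcave ρ) (hint : Integrable ρ) {i j : Fin n}
    (h4 : ∀ i, Integrable fun x => x i ^ 4 * ρ x) :
    Integrable fun x => defectKernel (x j) (x i) * ρ x := by
  have hdom : Integrable fun x => 10 * (ρ x + x i ^ 4 * ρ x + x j ^ 4 * ρ x) :=
    ((hint.add (h4 i)).add (h4 j)).const_mul 10
  refine hdom.mono ?_ (Filter.Eventually.of_forall fun x => ?_)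
  · have hD : Measurable fun x : Fin n → ℝ => defectKernel (x j) (x i) :=
      measurable_defectKernel.comp (g := fun p : ℝ × ℝ => defectKernel p.1 p.2)
        (f := fun x : Fin n → ℝ => (x j, x i))
        ((measurable_pi_apply j).prodMk (measurable_pi_apply i))
    exact hD.aestronglyMeasurable.mul h.aemeasurable.aestronglyMeasurable
  · rw [norm_mul, Real.norm_of_nonneg (h.nonneg x), Real.norm_eq_abs]
    refine le_trans (mul_le_mul_of_nonneg_right (abs_defectKernel_le _ _) (h.nonneg x)) ?_
    exact le_trans (le_of_eq (by ring)) (le_abs_self _)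

lemma integral_defectKernel_mul_nonneg (h : IsSymmetricLogConcave ρ) (hint : Integrable ρ)
    {i j : Fin n} (hij : i ≠ j) (h4 : ∀ i, Integrable fun x => x i ^ 4 * ρ x) :
    0 ≤ ∫ x, defectKernel (x j) (x i) * ρ x := by
  have hD := h.integrable_defectKernel hint (i := i) (j := j) h4
  obtain ⟨m, rfl⟩ : ∃ m, n = m + 1 := ⟨n - 1, by have := i.pos; omega⟩
  obtain ⟨k, rfl⟩ := Fin.exists_succAbove_eq hij.symm
  have he := (volume_preserving_piFinSuccAbove (fun _ : Fin (m + 1) => ℝ) i).symm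
  rw [← he.integral_comp', Measure.volume_eq_prod, integral_prod_symm]
  · refine integral_nonneg fun y => ?_
    have := integral_comp_abs_mul_nonneg (h := defectKernel (y k))
      (φ := fun a => ρ (i.insertNth (α := fun _ => ℝ) a y))
      (fun a b hab => h.anti fun l => ?_) (fun a => h.nonneg _)
      (measurable_defectKernel.comp measurable_prodMk_left)
      (fun T hT => integral_defectKernel_nonneg _ hT)
    · have hsymm : ∀ a, (MeasurableEquiv.piFinSuccAbove (fun _ : Fin (m + 1) => ℝ) i).symm (a, y) =
          i.insertNth (α := fun _ => ℝ) a y := fun _ => rfl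
      simpa [defectKernel_abs, hsymm] using this
    · rcases Fin.eq_self_or_eq_succAbove i l with rfl | ⟨l, rfl⟩
      · simpa using hab
      · simp
  · rw [← Measure.volume_eq_prod]
    exact (he.integrable_comp_emb (MeasurableEquiv.measurableEmbedding _)).2 hD

/-- The weighted integral of `(x i ^ 2 - x j ^ 2) ^ 2` is at least `8 / 5` for an isotropic
symmetric log-concave density. -/
lemma le_integral_sq_sub_sq (h : IsSymmetricLogConcave ρ) (hint : Integrable ρ)
    (hone : ∫ x, ρ x = 1) {i j : Fin n} (hij : i ≠ j)
    (h2 : ∀ i, Integrable fun x => x i ^ 2 * ρ x) (hsq : ∀ i, ∫ x, x i ^ 2 * ρ x = 1)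
    (h4 : ∀ i, Integrable fun x => x i ^ 4 * ρ x)
    (h22 : Integrable fun x => (x i ^ 2 - x j ^ 2) ^ 2 * ρ x) :
    8 / 5 ≤ ∫ x, (x i ^ 2 - x j ^ 2) ^ 2 * ρ x := by
  have hs : Integrable fun x => 8 / 5 * (x i ^ 2 * ρ x + x j ^ 2 * ρ x) :=
    ((h2 i).add (h2 j)).const_mul _
  have hd : Integrable fun x =>
      (x i ^ 2 - x j ^ 2) ^ 2 * ρ x - 8 / 5 * (x i ^ 2 * ρ x + x j ^ 2 * ρ x) := h22.sub hs
  have hle : ∫ x, (defectKernel (x j) (x i) * ρ x + defectKernel (x i) (x j) * ρ x) ≤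
      ∫ x, ((x i ^ 2 - x j ^ 2) ^ 2 * ρ x - 8 / 5 * (x i ^ 2 * ρ x + x j ^ 2 * ρ x) +
        8 / 5 * ρ x) := by
    refine integral_mono
      ((h.integrable_defectKernel hint h4).add (h.integrable_defectKernel hint h4))
      (hd.add (hint.const_mul _)) fun x => ?_
    have := mul_le_mul_of_nonneg_right (defectKernel_add_le (x i) (x j)) (h.nonneg x)
    simp only
    linarith
  rw [integral_add (h.integrable_defectKernel hint h4) (h.integrable_defectKernel hint h4),
    integral_add hd (hint.const_mul _),
    integral_sub h22 hs, integral_const_mul, integral_const_mul,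
    integral_add (h2 i) (h2 j), hsq, hsq, hone] at hle
  have hi := h.integral_defectKernel_mul_nonneg hint hij h4
  have hj := h.integral_defectKernel_mul_nonneg hint hij.symm h4
  linarith

end Defect

end IsSymmetricLogConcave

section Moments

variable {n : ℕ} {η : Measure (Fin n → ℝ)}

lemma measurePreserving_permEquiv_of_isHnInvariant (hinv : IsHnInvariant η)
    (σ : Equiv.Perm (Fin n)) : MeasurePreserving (permEquiv σ) η η :=
  ⟨(permEquiv σ).measurable, hinv.1 σ⟩

lemma measurePreserving_signEquiv_of_isHnInvariant (hinv : IsHnInvariant η)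
    (ε : Fin n → ℤˣ) : MeasurePreserving (signEquiv ε) η η :=
  ⟨(signEquiv ε).measurable, hinv.2 (fun i => ((ε i : ℤ) : ℝ)) fun i => by
    rcases Int.units_eq_one_or (ε i) with h | h <;> simp [h]⟩

lemma integral_comp_perm (hinv : IsHnInvariant η) (σ : Equiv.Perm (Fin n))
    (g : (Fin n → ℝ) → ℝ) : ∫ x, g (x ∘ σ) ∂η = ∫ x, g x ∂η :=
  (measurePreserving_permEquiv_of_isHnInvariant hinv σ).integral_comp' g

/-- A function that is odd in one coordinate integrates to zero. -/
lemma integral_eq_zero_of_odd (hinv : IsHnInvariant η) (k : Fin n) {g : (Fin n → ℝ) → ℝ}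
    (hg : ∀ x, g (fun i => (if i = k then -1 else 1) * x i) = -g x) : ∫ x, g x ∂η = 0 := by
  have h := (measurePreserving_signEquiv_of_isHnInvariant hinv
    (fun i => if i = k then -1 else 1)).integral_comp' g
  have hsign : ∀ x : Fin n → ℝ, signEquiv (fun i => if i = k then (-1 : ℤˣ) else 1) x =
      fun i => (if i = k then -1 else 1) * x i := by
    intro x
    ext i
    simp only [signEquiv, MeasurableEquiv.coe_mk, Equiv.coe_fn_mk]
    split_ifs <;> simp
  simp only [hsign, hg, integral_neg] at h
  linarith

lemma integral_pow_four_eq (hinv : IsHnInvariant η) (i j : Fin n) :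
    ∫ x, x i ^ 4 ∂η = ∫ x, x j ^ 4 ∂η := by
  rw [← integral_comp_perm hinv (Equiv.swap i j)]
  simp

lemma integral_sq_mul_sq_eq_left (hinv : IsHnInvariant η) {i j k : Fin n} (hij : i ≠ j)
    (hkj : k ≠ j) : ∫ x, x i ^ 2 * x j ^ 2 ∂η = ∫ x, x k ^ 2 * x j ^ 2 ∂η := by
  rw [← integral_comp_perm hinv (Equiv.swap i k)]
  simp [Equiv.swap_apply_of_ne_of_ne hij.symm hkj.symm]

lemma integral_sq_mul_sq_comm (i j : Fin n) :
    ∫ x, x i ^ 2 * x j ^ 2 ∂η = ∫ x, x j ^ 2 * x i ^ 2 ∂η := by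
  simp only [mul_comm]

lemma integral_sq_mul_sq_eq (hinv : IsHnInvariant η) {i j k l : Fin n} (hij : i ≠ j)
    (hkl : k ≠ l) : ∫ x, x i ^ 2 * x j ^ 2 ∂η = ∫ x, x k ^ 2 * x l ^ 2 ∂η := by
  by_cases hil : i = l
  · subst hil
    rw [integral_sq_mul_sq_comm, integral_sq_mul_sq_eq_left hinv hij.symm hkl]
  · rw [integral_sq_mul_sq_comm, integral_sq_mul_sq_eq_left hinv hij.symm (Ne.symm hil),
      integral_sq_mul_sq_comm, integral_sq_mul_sq_eq_left hinv hil hkl]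

lemma integral_withDensity_ofReal {ρ : (Fin n → ℝ) → ℝ} (h0 : ∀ x, 0 ≤ ρ x)
    (hm : AEMeasurable ρ) (g : (Fin n → ℝ) → ℝ) :
    ∫ x, g x ∂(volume.withDensity fun x => ENNReal.ofReal (ρ x)) = ∫ x, g x * ρ x := by
  rw [integral_withDensity_eq_integral_toReal_smul₀ hm.ennreal_ofReal (by simp)]
  simp [ENNReal.toReal_ofReal (h0 _), mul_comm]

lemma integrable_withDensity_ofReal_iff {ρ : (Fin n → ℝ) → ℝ} (h0 : ∀ x, 0 ≤ ρ x)
    (hm : AEMeasurable ρ) {g : (Fin n → ℝ) → ℝ} :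
    Integrable g (volume.withDensity fun x => ENNReal.ofReal (ρ x)) ↔
      Integrable fun x => g x * ρ x := by
  rw [integrable_withDensity_iff_integrable_smul₀' hm.ennreal_ofReal (by simp)]
  simp [ENNReal.toReal_ofReal (h0 _), mul_comm]

lemma integrable_mul_mul_mul (h4 : ∀ i, Integrable (fun x => x i ^ 4) η) (a b c d : Fin n) :
    Integrable (fun x => x a * x b * (x c * x d)) η := by
  refine ((((h4 a).add (h4 b)).add (h4 c)).add (h4 d)).mono
    (Measurable.aestronglyMeasurable (by fun_prop)) (Filter.Eventually.of_forall fun x => ?_)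
  simp only [Pi.add_apply, Real.norm_eq_abs]
  refine le_trans (abs_le.2 ⟨?_, ?_⟩) (le_abs_self _) <;>
  nlinarith [sq_nonneg (x a * x b + x c * x d), sq_nonneg (x a * x b - x c * x d),
    sq_nonneg (x a ^ 2 - x b ^ 2), sq_nonneg (x c ^ 2 - x d ^ 2), sq_nonneg (x a ^ 2),
    sq_nonneg (x b ^ 2), sq_nonneg (x c ^ 2), sq_nonneg (x d ^ 2)]

lemma integrable_mul (hiso : IsIsotropic η) [IsFiniteMeasure η] (a b : Fin n) :
    Integrable (fun x => x a * x b) η := by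
  have hsq : ∀ i, Integrable (fun x => x i ^ 2) η := fun i => by
    by_contra hcon
    have h := hiso.2 i i
    simp only [← sq] at h
    rw [integral_undef hcon] at h
    simp at h
  refine ((hsq a).add (hsq b)).mono
    (Measurable.aestronglyMeasurable (by fun_prop)) (Filter.Eventually.of_forall fun x => ?_)
  simp only [Pi.add_apply, Real.norm_eq_abs]
  refine le_trans (abs_le.2 ⟨?_, ?_⟩) (le_abs_self _) <;>
  nlinarith [sq_nonneg (x a + x b), sq_nonneg (x a - x b)]

/-- The moments of order four of an isotropic `H_n`-invariant log-concave measure. -/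
lemma exists_fourth_moments [IsProbabilityMeasure η] (hn : 2 ≤ n) (hinv : IsHnInvariant η)
    (hiso : IsIsotropic η) (hlc : IsLogConcave η) :
    ∃ A B : ℝ, (∀ i, Integrable (fun x => x i ^ 4) η) ∧ (∀ i, ∫ x, x i ^ 4 ∂η = A) ∧
      (∀ i j, i ≠ j → ∫ x, x i ^ 2 * x j ^ 2 ∂η = B) ∧ 4 / 5 ≤ A - B ∧ A ≤ 8192 * B := by
  obtain ⟨ρ, h, hη⟩ := exists_isSymmetricLogConcave hinv hlc
  have hI : ∀ g : (Fin n → ℝ) → ℝ, ∫ x, g x ∂η = ∫ x, g x * ρ x := fun g => by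
    rw [hη, integral_withDensity_ofReal h.nonneg h.aemeasurable]
  have hint : ∀ {g : (Fin n → ℝ) → ℝ}, Integrable g η ↔ Integrable fun x => g x * ρ x := by
    intro g
    rw [hη, integrable_withDensity_ofReal_iff h.nonneg h.aemeasurable]
  have hρ : Integrable ρ := by simpa using hint.1 (integrable_const (1 : ℝ))
  have hone : ∫ x, ρ x = 1 := by simpa using (hI fun _ => 1).symm
  have h2 : ∀ i, Integrable fun x => x i ^ 2 * ρ x := fun i => by
    simpa only [sq] using hint.1 (integrable_mul hiso i i)
  have hsq : ∀ i, ∫ x, x i ^ 2 * ρ x = 1 := fun i => by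
    rw [← hI]
    simpa [sq] using hiso.2 i i
  have h4ρ : ∀ i, Integrable fun x => x i ^ 4 * ρ x := fun i =>
    h.integrable_fourth_moment hρ hn i (h2 i)
  have h4 : ∀ i, Integrable (fun x => x i ^ 4) η := fun i => hint.2 (h4ρ i)
  have h22 : ∀ i j, Integrable (fun x => x i ^ 2 * x j ^ 2) η := fun i j => by
    simpa only [sq] using integrable_mul_mul_mul h4 i i j j
  let i : Fin n := ⟨0, by omega⟩
  let j : Fin n := ⟨1, by omega⟩
  have hij : i ≠ j := by simp [i, j]
  refine ⟨∫ x, x i ^ 4 ∂η, ∫ x, x i ^ 2 * x j ^ 2 ∂η, h4, fun k => integral_pow_four_eq hinv k i,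
    fun k l hkl => integral_sq_mul_sq_eq hinv hkl hij, ?_, ?_⟩
  · have hexp : (fun x : Fin n → ℝ => (x i ^ 2 - x j ^ 2) ^ 2) =
        fun x => x i ^ 4 + x j ^ 4 - 2 * (x i ^ 2 * x j ^ 2) := by
      ext x
      ring
    have hsub : Integrable (fun x => (x i ^ 2 - x j ^ 2) ^ 2) η := by
      rw [hexp]
      exact ((h4 i).add (h4 j)).sub ((h22 i j).const_mul 2)
    have hmain := h.le_integral_sq_sub_sq hρ hone hij h2 hsq h4ρ (hint.1 hsub)
    have hadd : Integrable (fun x => x i ^ 4 + x j ^ 4) η := (h4 i).add (h4 j)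
    rw [← hI fun x => (x i ^ 2 - x j ^ 2) ^ 2, hexp, integral_sub hadd ((h22 i j).const_mul 2),
      integral_add (h4 i) (h4 j), integral_const_mul, integral_pow_four_eq hinv j i] at hmain
    linarith
  · rw [hI, hI]
    exact h.fourth_moment_le hij (h4ρ i) (hint.1 (h22 i j))

end Moments

section QuadraticForm

variable {n : ℕ}

/-- The ordered pairs of indices, which index the quadratic monomials. -/
def orderedPairs (n : ℕ) : Finset (Fin n × Fin n) := Finset.univ.filter fun p => p.1 ≤ p.2

/-- The exponent of the monomial `x p.1 * x p.2`. -/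
def pairExponent (p : Fin n × Fin n) : Fin n →₀ ℕ :=
  Finsupp.single p.1 1 + Finsupp.single p.2 1

lemma pairExponent_injOn : Set.InjOn (pairExponent (n := n)) (orderedPairs n) := by
  rintro ⟨a, b⟩ hp ⟨c, d⟩ hq hpq
  simp only [orderedPairs, SetLike.mem_coe, Finset.mem_filter, Finset.mem_univ, true_and] at hp hq
  have := (Finsupp.single_add_single_eq_single_add_single one_ne_zero one_ne_zero).1 hpq
  rcases this with ⟨h1, h2⟩ | ⟨-, h1, h2⟩ | ⟨h, -⟩
  · exact Prod.ext h1 h2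
  · simp only at h1 h2
    subst h1 h2
    rw [le_antisymm hp hq]
  · simp at h

lemma exists_pairExponent_eq {I : Fin n →₀ ℕ} (hI : (I.sum fun _ e => e) = 2) :
    ∃ p ∈ orderedPairs n, pairExponent p = I := by
  have hcard : Multiset.card (Finsupp.toMultiset I) = 2 := by
    rw [Finsupp.card_toMultiset]
    exact hI
  obtain ⟨a, b, hab⟩ := Multiset.card_eq_two.1 hcard
  have hI' : I = pairExponent (a, b) := by
    rw [← Finsupp.toMultiset_toFinsupp I, hab, Multiset.insert_eq_cons, ← Multiset.singleton_add,
      map_add, Multiset.toFinsupp_singleton, Multiset.toFinsupp_singleton, pairExponent]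
  rcases le_total a b with h | h
  · exact ⟨(a, b), by simpa [orderedPairs] using h, hI'.symm⟩
  · exact ⟨(b, a), by simpa [orderedPairs] using h, by rw [hI', pairExponent, pairExponent, add_comm]⟩

/-- A homogeneous quadratic polynomial is a combination of the monomials `x p.1 * x p.2`, and
`coeffNorm 2` is the Euclidean norm of its coefficients. -/
lemma exists_quadratic_coefficients {f : MvPolynomial (Fin n) ℝ} (hf : f.IsHomogeneous 2)
    (hc : coeffNorm 2 f = 1) :
    ∃ c : Fin n × Fin n → ℝ, ∑ p ∈ orderedPairs n, c p ^ 2 = 1 ∧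
      ∀ x, MvPolynomial.eval x f = ∑ p ∈ orderedPairs n, c p * (x p.1 * x p.2) := by
  classical
  have hdeg : ∀ I ∈ f.support, (I.sum fun _ e => e) = 2 := fun I hI => by
    have := hf.degree_eq_sum_deg_support hI
    simpa [Finsupp.sum] using this.symm
  have hsub : f.support ⊆ (orderedPairs n).image pairExponent := fun I hI => by
    obtain ⟨p, hp, rfl⟩ := exists_pairExponent_eq (hdeg I hI)
    exact Finset.mem_image_of_mem _ hp
  refine ⟨fun p => f.coeff (pairExponent p), ?_, fun x => ?_⟩
  · rw [coeffNorm, Finset.filter_true_of_mem hdeg, Real.sqrt_eq_one] at hc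
    rw [← hc, Finset.sum_subset hsub, Finset.sum_image pairExponent_injOn]
    intro I _ hI
    simp [MvPolynomial.notMem_support_iff.1 hI]
  · rw [MvPolynomial.eval_eq', Finset.sum_subset hsub, Finset.sum_image pairExponent_injOn]
    · refine Finset.sum_congr rfl fun p _ => ?_
      congr 1
      simp only [pairExponent, Finsupp.add_apply, pow_add, Finset.prod_mul_distrib]
      simp [Finsupp.single_apply, pow_ite]
    · intro I _ hI
      simp [MvPolynomial.notMem_support_iff.1 hI]

variable {η : Measure (Fin n → ℝ)} {A B : ℝ}

/-- The matrix of fourth moments indexed by quadratic monomials. -/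
lemma integral_mul_mul_mul_eq (hinv : IsHnInvariant η) (hA : ∀ i, ∫ x, x i ^ 4 ∂η = A)
    (hB : ∀ i j, i ≠ j → ∫ x, x i ^ 2 * x j ^ 2 ∂η = B) {p q : Fin n × Fin n}
    (hp : p ∈ orderedPairs n) (hq : q ∈ orderedPairs n) :
    ∫ x, x p.1 * x p.2 * (x q.1 * x q.2) ∂η =
      (if p = q then (if p.1 = p.2 then A - B else B) else 0) +
        B * ((if p.1 = p.2 then 1 else 0) * (if q.1 = q.2 then 1 else 0)) := by
  obtain ⟨a, b⟩ := p
  obtain ⟨c, d⟩ := q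
  simp only [orderedPairs, Finset.mem_filter, Finset.mem_univ, true_and] at hp hq
  have hodd : ∀ k : Fin n,
      ((if a = k then -1 else 1) * (if b = k then -1 else 1) *
        ((if c = k then -1 else 1) * (if d = k then -1 else 1)) : ℝ) = -1 →
      ∫ x, x a * x b * (x c * x d) ∂η = 0 := fun k hk =>
    integral_eq_zero_of_odd hinv k fun x => by
      linear_combination (x a * x b * (x c * x d)) * hk
  simp only [Prod.mk.injEq]
  by_cases hab : a = b
  · subst hab
    by_cases hcd : c = d
    · subst hcd
      by_cases hac : a = c
      · subst hac
        simp only [and_self, if_true, mul_one, sub_add_cancel, ← hA a]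
        congr 1
        ext x
        ring
      · simp only [hac, and_self, if_false, if_true, mul_one, zero_add, ← hB a c hac]
        congr 1
        ext x
        ring
    · have hne : ¬(a = c ∧ a = d) := fun h => hcd (h.1.symm.trans h.2)
      simp only [hne, hcd, if_false, mul_zero, add_zero]
      refine hodd c ?_
      by_cases hac : a = c <;> simp [hac, Ne.symm hcd]
  · by_cases hpq : a = c ∧ b = d
    · obtain ⟨rfl, rfl⟩ := hpq
      simp only [and_self, hab, if_true, if_false, mul_zero, add_zero, ← hB a b hab]
      congr 1
      ext x
      ring
    · simp only [hpq, hab, if_false, zero_mul, mul_zero, add_zero]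
      by_cases hca : c = a
      · subst hca
        by_cases hdc : d = c
        · subst hdc
          exact hodd b (by simp [hab])
        · exact hodd b (by simp_all [eq_comm])
      · by_cases hda : d = a
        · subst hda
          refine hodd b ?_
          have hcb : c ≠ b := fun h => hab (le_antisymm hp (h ▸ hq))
          simp [hab, hcb]
        · exact hodd a (by simp [hca, hda, Ne.symm hab])

end QuadraticForm

section QuadraticForm

variable {n : ℕ} {η : Measure (Fin n → ℝ)} {A B : ℝ}

lemma integral_quadratic [IsFiniteMeasure η] (hiso : IsIsotropic η) (c : Fin n × Fin n → ℝ) :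
    ∫ x, ∑ p ∈ orderedPairs n, c p * (x p.1 * x p.2) ∂η =
      ∑ p ∈ orderedPairs n, if p.1 = p.2 then c p else 0 := by
  rw [integral_finsetSum _ fun p _ => (integrable_mul hiso p.1 p.2).const_mul (c p)]
  refine Finset.sum_congr rfl fun p _ => ?_
  rw [integral_const_mul, hiso.2]
  simp

lemma integral_quadratic_sq (hinv : IsHnInvariant η) (h4 : ∀ i, Integrable (fun x => x i ^ 4) η)
    (hA : ∀ i, ∫ x, x i ^ 4 ∂η = A)
    (hB : ∀ i j, i ≠ j → ∫ x, x i ^ 2 * x j ^ 2 ∂η = B) (c : Fin n × Fin n → ℝ) :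
    ∫ x, (∑ p ∈ orderedPairs n, c p * (x p.1 * x p.2)) ^ 2 ∂η =
      (A - B) * (∑ p ∈ orderedPairs n, if p.1 = p.2 then c p ^ 2 else 0) +
        B * (∑ p ∈ orderedPairs n, if p.1 = p.2 then 0 else c p ^ 2) +
        B * (∑ p ∈ orderedPairs n, if p.1 = p.2 then c p else 0) ^ 2 := by
  have hexp : (fun x : Fin n → ℝ => (∑ p ∈ orderedPairs n, c p * (x p.1 * x p.2)) ^ 2) =
      fun x => ∑ p ∈ orderedPairs n, ∑ q ∈ orderedPairs n,
        c p * c q * (x p.1 * x p.2 * (x q.1 * x q.2)) := by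
    ext x
    rw [sq, Finset.sum_mul_sum]
    refine Finset.sum_congr rfl fun p _ => Finset.sum_congr rfl fun q _ => ?_
    ring
  have hint : ∀ p q : Fin n × Fin n,
      Integrable (fun x => c p * c q * (x p.1 * x p.2 * (x q.1 * x q.2))) η := fun p q =>
    (integrable_mul_mul_mul h4 p.1 p.2 q.1 q.2).const_mul _
  rw [hexp, integral_finsetSum _ fun p _ => integrable_finsetSum _ fun q _ => hint p q]
  have hrow : ∀ p ∈ orderedPairs n,
      ∫ x, ∑ q ∈ orderedPairs n, c p * c q * (x p.1 * x p.2 * (x q.1 * x q.2)) ∂η =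
        ((A - B) * (if p.1 = p.2 then c p ^ 2 else 0) +
          B * (if p.1 = p.2 then 0 else c p ^ 2)) +
        B * ((if p.1 = p.2 then c p else 0) *
          ∑ q ∈ orderedPairs n, if q.1 = q.2 then c q else 0) := by
    intro p hp
    rw [integral_finsetSum _ fun q _ => hint p q]
    have hterm : ∀ q ∈ orderedPairs n,
        ∫ x, c p * c q * (x p.1 * x p.2 * (x q.1 * x q.2)) ∂η =
          (if p = q then (A - B) * (if p.1 = p.2 then c p ^ 2 else 0) +
            B * (if p.1 = p.2 then 0 else c p ^ 2) else 0) +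
          B * ((if p.1 = p.2 then c p else 0) * (if q.1 = q.2 then c q else 0)) := by
      intro q hq
      rw [integral_const_mul, integral_mul_mul_mul_eq hinv hA hB hp hq]
      by_cases hpq : p = q
      · subst hpq
        split_ifs <;> ring
      · simp only [hpq, if_false]
        split_ifs <;> ring
    rw [Finset.sum_congr rfl hterm, Finset.sum_add_distrib, Finset.sum_ite_eq, if_pos hp,
      ← Finset.mul_sum, ← Finset.mul_sum]
  rw [Finset.sum_congr rfl hrow, Finset.sum_add_distrib, Finset.sum_add_distrib, ← Finset.mul_sum,
    ← Finset.mul_sum, ← Finset.mul_sum, ← Finset.sum_mul]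
  ring

lemma sum_orderedPairs_diagonal (g : Fin n → ℝ) :
    ∑ p ∈ orderedPairs n, (if p.1 = p.2 then g p.1 else 0) = ∑ i, g i := by
  rw [orderedPairs, Finset.sum_filter, Fintype.sum_prod_type]
  refine Finset.sum_congr rfl fun i _ => ?_
  rw [Finset.sum_eq_single i]
  · simp
  · intro j _ hj
    simp [hj.symm]
  · simp

lemma sq_sum_diagonal_le (c : Fin n × Fin n → ℝ) :
    (∑ p ∈ orderedPairs n, if p.1 = p.2 then c p else 0) ^ 2 ≤
      n * ∑ p ∈ orderedPairs n, if p.1 = p.2 then c p ^ 2 else 0 := by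
  have h1 : ∀ p : Fin n × Fin n, (if p.1 = p.2 then c p else 0) =
      if p.1 = p.2 then c (p.1, p.1) else 0 := by
    rintro ⟨a, b⟩
    by_cases h : a = b
    · subst h
      rfl
    · simp [h]
  have h2 : ∀ p : Fin n × Fin n, (if p.1 = p.2 then c p ^ 2 else 0) =
      if p.1 = p.2 then c (p.1, p.1) ^ 2 else 0 := by
    rintro ⟨a, b⟩
    by_cases h : a = b
    · subst h
      rfl
    · simp [h]
  simp only [h1, h2, sum_orderedPairs_diagonal fun i => c (i, i),
    sum_orderedPairs_diagonal fun i => c (i, i) ^ 2]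
  simpa using sq_sum_le_card_mul_sum_sq (s := (Finset.univ : Finset (Fin n)))
    (f := fun i => c (i, i))

lemma mVar_quadratic [IsFiniteMeasure η] (hiso : IsIsotropic η) (hinv : IsHnInvariant η)
    (h4 : ∀ i, Integrable (fun x => x i ^ 4) η) (hA : ∀ i, ∫ x, x i ^ 4 ∂η = A)
    (hB : ∀ i j, i ≠ j → ∫ x, x i ^ 2 * x j ^ 2 ∂η = B) (c : Fin n × Fin n → ℝ) :
    mVar η (fun x => ∑ p ∈ orderedPairs n, c p * (x p.1 * x p.2)) =
      (A - B) * (∑ p ∈ orderedPairs n, if p.1 = p.2 then c p ^ 2 else 0) +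
        B * (∑ p ∈ orderedPairs n, if p.1 = p.2 then 0 else c p ^ 2) +
        (B - 1) * (∑ p ∈ orderedPairs n, if p.1 = p.2 then c p else 0) ^ 2 := by
  rw [mVar, integral_quadratic_sq hinv h4 hA hB, integral_quadratic hiso]
  ring

lemma mVar_normalized_sq_norm [IsFiniteMeasure η] (hn : 0 < n) (hiso : IsIsotropic η)
    (hinv : IsHnInvariant η)
    (h4 : ∀ i, Integrable (fun x => x i ^ 4) η) (hA : ∀ i, ∫ x, x i ^ 4 ∂η = A)
    (hB : ∀ i j, i ≠ j → ∫ x, x i ^ 2 * x j ^ 2 ∂η = B) :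
    mVar η (fun x => (Real.sqrt n)⁻¹ * ∑ i, x i ^ 2) = A - B + (B - 1) * n := by
  have hn' : (0 : ℝ) < n := Nat.cast_pos.2 hn
  have hsq : (Real.sqrt n)⁻¹ ^ 2 = (n : ℝ)⁻¹ := by rw [inv_pow, Real.sq_sqrt hn'.le]
  have hform : (fun x : Fin n → ℝ => (Real.sqrt n)⁻¹ * ∑ i, x i ^ 2) = fun x =>
      ∑ p ∈ orderedPairs n, (if p.1 = p.2 then (Real.sqrt n)⁻¹ else 0) * (x p.1 * x p.2) := by
    ext x
    rw [Finset.mul_sum, ← sum_orderedPairs_diagonal]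
    refine Finset.sum_congr rfl fun p _ => ?_
    split_ifs with h
    · rw [← h, sq]
    · simp
  rw [hform, mVar_quadratic hiso hinv h4 hA hB]
  have e1 : ∀ p : Fin n × Fin n,
      (if p.1 = p.2 then (if p.1 = p.2 then (Real.sqrt n)⁻¹ else 0) ^ 2 else 0) =
        if p.1 = p.2 then (n : ℝ)⁻¹ else 0 := fun p => by split_ifs <;> simp [hsq]
  have e2 : ∀ p : Fin n × Fin n,
      (if p.1 = p.2 then 0 else (if p.1 = p.2 then (Real.sqrt n)⁻¹ else 0) ^ 2) = 0 := fun p => by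
    split_ifs <;> simp
  have e3 : ∀ p : Fin n × Fin n,
      (if p.1 = p.2 then (if p.1 = p.2 then (Real.sqrt n)⁻¹ else 0) else 0) =
        if p.1 = p.2 then (Real.sqrt n)⁻¹ else 0 := fun p => by split_ifs <;> simp
  simp only [e1, e2, e3, sum_orderedPairs_diagonal fun _ => (n : ℝ)⁻¹,
    sum_orderedPairs_diagonal fun _ => (Real.sqrt n)⁻¹, Finset.sum_const, Finset.card_univ,
    Fintype.card_fin, nsmul_eq_mul, mul_pow, hsq]
  field_simp
  ring

lemma mVar_nonneg [IsProbabilityMeasure η] {g : (Fin n → ℝ) → ℝ} (hg : MemLp g 2 η) :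
    0 ≤ mVar η g := by
  have := ProbabilityTheory.variance_nonneg g η
  rwa [ProbabilityTheory.variance_eq_sub hg] at this

lemma memLp_normalized_sq_norm (h4 : ∀ i, Integrable (fun x => x i ^ 4) η) :
    MemLp (fun x : Fin n → ℝ => (Real.sqrt n)⁻¹ * ∑ i, x i ^ 2) 2 η := by
  refine MemLp.const_mul ?_ _
  refine memLp_finsetSum _ fun i _ => ?_
  rw [memLp_two_iff_integrable_sq (Measurable.aestronglyMeasurable (by fun_prop))]
  simpa only [← pow_mul] using h4 i

end QuadraticForm

section OneDimensional

lemma mVar_quadratic_fin_one {η : Measure (Fin 1 → ℝ)} {c : Fin 1 × Fin 1 → ℝ}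
    (hc : ∑ p ∈ orderedPairs 1, c p ^ 2 = 1) :
    mVar η (fun x => ∑ p ∈ orderedPairs 1, c p * (x p.1 * x p.2)) =
      mVar η (fun x => (Real.sqrt (1 : ℕ))⁻¹ * ∑ i, x i ^ 2) := by
  have hP : orderedPairs 1 = {(0, 0)} := by decide
  simp only [hP, Finset.sum_singleton] at hc ⊢
  simp only [mVar, mul_pow, integral_const_mul, hc]
  simp [← sq]

end OneDimensional
/-- Proposition A.3: for an `H_n`-invariant, isotropic, log-concave probability measure `η`
on ℝ^n and any degree-2 homogeneous polynomial `f` with `coeff_2(f) = 1`: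
`∫ f² dη ≥ 4/5 - C/n` and `Var_η(f) ≥ min(Var_η(n^{-1/2}‖x‖₂²), 4/5 - C/n)` for a universal
constant `C ≥ 0`. -/
theorem quadratic_second_moment_and_variance_bound :
    ∃ C : ℝ, 0 ≤ C ∧
      ∀ (n : ℕ), 1 ≤ n → ∀ η : Measure (Fin n → ℝ),
        IsProbabilityMeasure η → IsHnInvariant η → IsIsotropic η → IsLogConcave η →
        ∀ f : MvPolynomial (Fin n) ℝ,
          f.IsHomogeneous 2 → coeffNorm 2 f = 1 →
          (4 / 5 - C / n ≤ ∫ x, (MvPolynomial.eval x f) ^ 2 ∂η) ∧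
          (min (mVar η (fun x => (Real.sqrt n)⁻¹ * ∑ i, x i ^ 2)) (4 / 5 - C / n)
            ≤ mVar η (fun x => MvPolynomial.eval x f)) := by
  refine ⟨8192, by norm_num, ?_⟩
  intro n hn η hprob hinv hiso hlc f hf hcf
  obtain ⟨c, hc, hfc⟩ := exists_quadratic_coefficients hf hcf
  simp only [hfc]
  have hn0 : (0 : ℝ) < n := Nat.cast_pos.2 hn
  rcases hn.eq_or_lt with rfl | hn2
  · refine ⟨?_, (min_le_left _ _).trans (mVar_quadratic_fin_one hc).ge⟩
    refine le_trans (by norm_num) (integral_nonneg fun x => sq_nonneg _)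
  obtain ⟨A, B, h4, hA, hB, hAB, hAB'⟩ := exists_fourth_moments hn2 hinv hiso hlc
  have hV := mVar_normalized_sq_norm hn hiso hinv h4 hA hB
  have hV0 := mVar_nonneg (memLp_normalized_sq_norm h4)
  rw [integral_quadratic_sq hinv h4 hA hB, mVar_quadratic hiso hinv h4 hA hB, hV]
  rw [hV] at hV0
  have hcauchy := sq_sum_diagonal_le c
  have hS := sq_nonneg (∑ p ∈ orderedPairs n, if p.1 = p.2 then c p else 0)
  have huw : (∑ p ∈ orderedPairs n, if p.1 = p.2 then c p ^ 2 else 0) +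
      (∑ p ∈ orderedPairs n, if p.1 = p.2 then 0 else c p ^ 2) = 1 := by
    rw [← Finset.sum_add_distrib, ← hc]
    exact Finset.sum_congr rfl fun p _ => by split_ifs <;> simp
  have hu : 0 ≤ ∑ p ∈ orderedPairs n, if p.1 = p.2 then c p ^ 2 else 0 :=
    Finset.sum_nonneg fun p _ => by split_ifs <;> positivity
  have hw : 0 ≤ ∑ p ∈ orderedPairs n, if p.1 = p.2 then 0 else c p ^ 2 :=
    Finset.sum_nonneg fun p _ => by split_ifs <;> positivity
  generalize (∑ p ∈ orderedPairs n, if p.1 = p.2 then c p ^ 2 else 0) = u at *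
  generalize (∑ p ∈ orderedPairs n, if p.1 = p.2 then 0 else c p ^ 2) = w at *
  generalize (∑ p ∈ orderedPairs n, if p.1 = p.2 then c p else 0) ^ 2 = S at *
  have hB0 : 0 ≤ B := by linarith
  have hBn : 1 - 8192 / n ≤ B := by
    have h1 : (n : ℝ) - 8191 * B ≤ n * B := by linarith
    have h2 : (n : ℝ) - 8192 ≤ n * B := by
      rcases le_total B 1 with h | h
      · linarith
      · have := mul_le_mul_of_nonneg_left h hn0.le
        linarith
    rw [sub_le_iff_le_add, ← sub_le_iff_le_add', le_div_iff₀ hn0]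
    linarith
  have hq : (0 : ℝ) ≤ 8192 / n := by positivity
  have hmain : 4 / 5 - 8192 / n ≤ (A - B) * u + B * w := by
    have h1 : (4 / 5 - 8192 / n) * u ≤ (A - B) * u := mul_le_mul_of_nonneg_right (by linarith) hu
    have h2 : (4 / 5 - 8192 / n) * w ≤ B * w := mul_le_mul_of_nonneg_right (by linarith) hw
    calc (4 / 5 - 8192 / n : ℝ) = (4 / 5 - 8192 / n) * u + (4 / 5 - 8192 / n) * w := by
          rw [← mul_add, huw, mul_one]
      _ ≤ _ := add_le_add h1 h2
  refine ⟨?_, ?_⟩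
  · have := mul_nonneg hB0 hS
    linarith
  · rcases le_total 1 B with h | h
    · refine (min_le_right _ _).trans ?_
      have := mul_nonneg (sub_nonneg.2 h) hS
      linarith
    · have h1 := mul_le_mul_of_nonneg_right
        (min_le_left (A - B + (B - 1) * n) (4 / 5 - 8192 / n : ℝ)) hu
      have h2 := mul_le_mul_of_nonneg_right
        ((min_le_right (A - B + (B - 1) * n) (4 / 5 - 8192 / n : ℝ)).trans
          (by linarith : _ ≤ B)) hw
      have h3 := mul_le_mul_of_nonneg_left hcauchy (sub_nonneg.2 h)
      have h4 : min (A - B + (B - 1) * n) (4 / 5 - 8192 / n : ℝ) * (u + w) ≤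
          (A - B) * u + B * w + (B - 1) * S := by linarith
      rwa [huw, mul_one] at h4
end
end
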